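/- Under the assumptions (A1)–(A8) of the iteration lemma (with parameters γ ∈ (0,1), d sufficiently large, 1 ≤ k ≤ d^{2γ}, 4ηd < ℓ < 100d, 1/log⁵(d) < η < 1/log(d/√k), d^{−γ(1−√γ)/200} ≤ β ≤ 1/10, H k-locally-sparse, Δ(H) ≤ 2d, (1−β)ℓ/2 ≤ |L(v)| ≤ (1+β)ℓ, avg-deg_ℋ(v) ≤ (2 − (1−β)ℓ/|L(v)|)d), run the Wasteful Coloring Procedure randomness and define keep := (1 − η/ℓ)^{2d}, uncolor := (1 − η/ℓ)^{keep·ℓ/2}, ℓ' := keep·ℓ, d' := keep·uncolor·d, β' := (1+36η)β, L'(v) := {c ∈ K(v) : |N_H(c) ∩ K ∩ U| ≤ 2d'}, ℓ'(v) := |L'(v)|, λ'(v) := ℓ'(v)/ℓ', d̄(v) := (1/ℓ'(v)) Σ_{c ∈ L'(v)} |N_H(c) ∩ V(H')| where V(H') := ∪_{u uncolored} L'(u), and δ'(v) := λ'(v)·d̄(v) + (1 − λ'(v))·2d'. Then for each vertex v ∈ V(G), Pr[δ'(v) ≤ (1 + β')d'] ≥ 1 − d^{−50}. -/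

import Mathlib

open Finset

attribute [local instance] Classical.propDecidable

noncomputable section

/-- The number of ordered pairs of adjacent vertices inside `S`; this is exactly twice the
number of edges of the subgraph induced on `S`. -/
def pairsWithin {C : Type} [Fintype C] (H : SimpleGraph C) (S : Finset C) : ℕ :=
  ((S ×ˢ S).filter fun p => H.Adj p.1 p.2).card

/-- `H` is `k`-locally-sparse: each neighborhood induces at most `k` edges. -/
def LocallySparse {C : Type} [Fintype C] (H : SimpleGraph C) (k : ℝ) : Prop :=
  ∀ c : C, (pairsWithin H (H.neighborFinset c) : ℝ) ≤ 2 * k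

/-- `(L, H)` is a correspondence cover of `G`. -/
structure IsCorrespondenceCover {V C : Type} (G : SimpleGraph V) (H : SimpleGraph C)
    (L : V → Finset C) : Prop where
  partition : ∀ c : C, ∃! v : V, c ∈ L v
  indep : ∀ v : V, ∀ c ∈ L v, ∀ c' ∈ L v, ¬H.Adj c c'
  matching : ∀ u v : V, ∀ c ∈ L u, ∀ c₁ ∈ L v, ∀ c₂ ∈ L v,
    H.Adj c c₁ → H.Adj c c₂ → c₁ = c₂
  not_adj : ∀ u v : V, ¬G.Adj u v → ∀ c ∈ L u, ∀ c' ∈ L v, ¬H.Adj c c'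

/-! ### The Wasteful Coloring Procedure randomness

An outcome of the randomness is a function `ω : C → Bool × Bool`, where `(ω c).1` records
whether the color `c` is activated and `(ω c).2` records its equalizing coin flip `eq(c)`.
The colors are activated independently with probability `η/ℓ`, and
`eq(c) ~ Bernoulli(keep/(1-η/ℓ)^{deg_H(c)})` with `keep = (1-η/ℓ)^{2d}`, all mutually
independent; accordingly each outcome `ω` carries the product Bernoulli weight below, and
probabilities (resp. expectations) are weighted sums over outcomes. -/

/-- The weight `p` or `1 - p` of a single Bernoulli(`p`) outcome. -/
def bern (p : ℝ) (b : Bool) : ℝ := if b then p else 1 - p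

/-- The probability of the outcome `ω` of the Wasteful Coloring Procedure randomness. -/
def wcpWeight {C : Type} [Fintype C] (H : SimpleGraph C) (η ℓ d : ℝ)
    (ω : C → Bool × Bool) : ℝ :=
  ∏ c : C, bern (η / ℓ) (ω c).1 *
    bern ((1 - η / ℓ) ^ (2 * d) / (1 - η / ℓ) ^ ((H.degree c : ℝ))) (ω c).2

/-- The set `A` of activated colors. -/
def Aset {C : Type} [Fintype C] (ω : C → Bool × Bool) : Finset C :=
  univ.filter fun c => (ω c).1 = true

/-- The set `K` of kept colors: `eq(c) = 1` and no neighbor of `c` is activated. -/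
def Kset {C : Type} [Fintype C] (H : SimpleGraph C) (ω : C → Bool × Bool) : Finset C :=
  univ.filter fun c => (ω c).2 = true ∧ ∀ c' ∈ H.neighborFinset c, (ω c').1 = false

/-- The set `U` of colors whose underlying vertex is uncolored, i.e. `A(v) ∩ K(v) = ∅`. -/
def Uset {V C : Type} [Fintype V] [Fintype C] (H : SimpleGraph C) (L : V → Finset C)
    (ω : C → Bool × Bool) : Finset C :=
  univ.filter fun c => ∀ v : V, c ∈ L v → L v ∩ Aset ω ∩ Kset H ω = ∅

/-- The probability of an event under the Wasteful Coloring Procedure randomness. -/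
def wcpPr {C : Type} [Fintype C] (H : SimpleGraph C) (η ℓ d : ℝ)
    (E : (C → Bool × Bool) → Prop) : ℝ :=
  ∑ ω ∈ univ.filter E, wcpWeight H η ℓ d ω

/-- The expectation of a random variable under the Wasteful Coloring Procedure randomness. -/
def wcpExp {C : Type} [Fintype C] (H : SimpleGraph C) (η ℓ d : ℝ)
    (f : (C → Bool × Bool) → ℝ) : ℝ :=
  ∑ ω : C → Bool × Bool, wcpWeight H η ℓ d ω * f ω

/-- The set of edges `E_K(v)`, encoded as ordered pairs `(c, c')` with `c ∈ L(v)`,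
`c' ∈ N_H(c)` and `c, c' ∈ K` (each such edge has exactly one endpoint in `L(v)`). -/
def EK {V C : Type} [Fintype C] (H : SimpleGraph C) (L : V → Finset C) (v : V)
    (ω : C → Bool × Bool) : Finset (C × C) :=
  ((L v) ×ˢ (univ : Finset C)).filter fun p =>
    H.Adj p.1 p.2 ∧ p.1 ∈ Kset H ω ∧ p.2 ∈ Kset H ω

/-- The set of edges `E_U(v)`, encoded as ordered pairs `(c, c')` with `c ∈ L(v)`,
`c' ∈ N_H(c)` and `c' ∈ U`. -/
def EU {V C : Type} [Fintype V] [Fintype C] (H : SimpleGraph C) (L : V → Finset C) (v : V)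
    (ω : C → Bool × Bool) : Finset (C × C) :=
  ((L v) ×ˢ (univ : Finset C)).filter fun p =>
    H.Adj p.1 p.2 ∧ p.2 ∈ Uset H L ω

def Wt {C : Type} [Fintype C] (w : C → Bool × Bool → ℝ) (ω : C → Bool × Bool) : ℝ :=
  ∏ c, w c (ω c)

def Ex {C : Type} [Fintype C] (w : C → Bool × Bool → ℝ) (f : (C → Bool × Bool) → ℝ) : ℝ :=
  ∑ ω, Wt w ω * f ω

/-- weights are a probability distribution at each coordinate -/
structure IsPr {C : Type} [Fintype C] (w : C → Bool × Bool → ℝ) : Prop where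
  nn : ∀ c b, 0 ≤ w c b
  one : ∀ c, ∑ b, w c b = 1

set_option linter.unusedSectionVars false

section
variable {C : Type} [Fintype C] {w : C → Bool × Bool → ℝ}

lemma Wt_nonneg (hw : IsPr w) (ω) : 0 ≤ Wt w ω := Finset.prod_nonneg fun c _ => hw.nn c _

lemma Ex_prod (h : C → Bool × Bool → ℝ) :
    Ex w (fun ω => ∏ c, h c (ω c)) = ∏ c, ∑ b, w c b * h c b := by
  unfold Ex Wt
  rw [Finset.prod_univ_sum]
  rw [Fintype.piFinset_univ]
  refine Finset.sum_congr rfl fun ω _ => ?_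
  rw [Finset.prod_mul_distrib]

lemma Ex_mono (hw : IsPr w) {f g : (C → Bool × Bool) → ℝ} (h : ∀ ω, f ω ≤ g ω) :
    Ex w f ≤ Ex w g :=
  Finset.sum_le_sum fun ω _ => mul_le_mul_of_nonneg_left (h ω) (Wt_nonneg hw ω)

lemma Ex_add (f g : (C → Bool × Bool) → ℝ) : Ex w (fun ω => f ω + g ω) = Ex w f + Ex w g := by
  simp only [Ex, mul_add, Finset.sum_add_distrib]

lemma Ex_smul (a : ℝ) (f : (C → Bool × Bool) → ℝ) : Ex w (fun ω => a * f ω) = a * Ex w f := by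
  simp only [Ex, Finset.mul_sum]
  exact Finset.sum_congr rfl fun _ _ => by ring

lemma Ex_sum {ι : Type*} (s : Finset ι) (f : ι → (C → Bool × Bool) → ℝ) :
    Ex w (fun ω => ∑ i ∈ s, f i ω) = ∑ i ∈ s, Ex w (f i) := by
  simp only [Ex, Finset.mul_sum]
  rw [Finset.sum_comm]

lemma Wt_total (hw : IsPr w) : ∑ ω, Wt w ω = 1 := by
  have := Ex_prod (w := w) (fun _ _ => 1)
  simp only [Ex, Finset.prod_const_one, mul_one] at this
  rw [this]; simp [hw.one]

lemma Ex_const (hw : IsPr w) (a : ℝ) : Ex w (fun _ => a) = a := by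
  simp only [Ex, ← Finset.sum_mul, Wt_total hw, one_mul]

lemma Ex_nonneg (hw : IsPr w) {f : (C → Bool × Bool) → ℝ} (h : ∀ ω, 0 ≤ f ω) : 0 ≤ Ex w f :=
  Finset.sum_nonneg fun ω _ => mul_nonneg (Wt_nonneg hw ω) (h ω)

/-- merge: coordinates in `B` from `ω`, others from `ω'`. -/
def mrg (B : Finset C) (ω ω' : C → Bool × Bool) : C → Bool × Bool :=
  fun c => if c ∈ B then ω c else ω' c

lemma Wt_mrg (B : Finset C) (ω ω' : C → Bool × Bool) :
    Wt w (mrg B ω ω') * Wt w (mrg B ω' ω) = Wt w ω * Wt w ω' := by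
  unfold Wt
  rw [← Finset.prod_mul_distrib, ← Finset.prod_mul_distrib]
  refine Finset.prod_congr rfl fun c _ => ?_
  unfold mrg
  split_ifs <;> ring

lemma mrg_mrg (B : Finset C) (ω ω' : C → Bool × Bool) :
    mrg B (mrg B ω ω') (mrg B ω' ω) = ω := by
  funext c; unfold mrg; split_ifs <;> rfl

lemma Ex_swap (hw : IsPr w) (B : Finset C) (F : (C → Bool × Bool) → ℝ) :
    Ex w (fun ω => Ex w (fun ω' => F (mrg B ω ω'))) = Ex w F := by
  have h1 : Ex w (fun ω => Ex w (fun ω' => F (mrg B ω ω')))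
      = ∑ z : (C → Bool × Bool) × (C → Bool × Bool), Wt w z.1 * Wt w z.2 * F (mrg B z.1 z.2) := by
    rw [Fintype.sum_prod_type]
    simp only [Ex, Finset.mul_sum, mul_assoc]
  have h2 : ∑ z : (C → Bool × Bool) × (C → Bool × Bool), Wt w z.1 * Wt w z.2 * F (mrg B z.1 z.2)
      = ∑ z : (C → Bool × Bool) × (C → Bool × Bool), Wt w z.1 * Wt w z.2 * F z.1 := by
    refine Finset.sum_nbij' (fun z => (mrg B z.1 z.2, mrg B z.2 z.1))
      (fun z => (mrg B z.1 z.2, mrg B z.2 z.1)) ?_ ?_ ?_ ?_ ?_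
    · intros; simp
    · intros; simp
    · rintro ⟨a, b⟩ _; simp [mrg_mrg]
    · rintro ⟨a, b⟩ _; simp [mrg_mrg]
    · rintro ⟨a, b⟩ _; simp [Wt_mrg]
  rw [h1, h2, Fintype.sum_prod_type]
  unfold Ex
  refine Finset.sum_congr rfl fun ω _ => ?_
  simp only
  rw [← Finset.sum_mul, ← Finset.mul_sum, Wt_total hw, mul_one]

/-- `f` depends only on the coordinates in `B`. -/
def DepOn (B : Finset C) (f : (C → Bool × Bool) → ℝ) : Prop :=
  ∀ ω ω', (∀ c ∈ B, ω c = ω' c) → f ω = f ω'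

lemma Ex_indep (hw : IsPr w) {B B' : Finset C} (hB : Disjoint B B')
    {f g : (C → Bool × Bool) → ℝ} (hf : DepOn B f) (hg : DepOn B' g) :
    Ex w (fun ω => f ω * g ω) = Ex w f * Ex w g := by
  rw [← Ex_swap hw B]
  have : ∀ ω ω', f (mrg B ω ω') * g (mrg B ω ω') = f ω * g ω' := by
    intro ω ω'
    rw [hf (mrg B ω ω') ω, hg (mrg B ω ω') ω']
    · intro c hc
      have : c ∉ B := fun h => Finset.disjoint_left.1 hB h hc
      simp [mrg, this]
    · intro c hc; simp [mrg, hc]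
  simp only [this, Ex_smul]
  simp only [Ex, Finset.sum_mul]
  exact Finset.sum_congr rfl fun _ _ => by ring

lemma DepOn.mono {B B' : Finset C} (h : B ⊆ B') {f : (C → Bool × Bool) → ℝ} (hf : DepOn B f) :
    DepOn B' f := fun ω ω' hh => hf ω ω' fun c hc => hh c (h hc)

lemma DepOn.prod {ι : Type*} (J : Finset ι) (B : ι → Finset C)
    (g : ι → (C → Bool × Bool) → ℝ) (hg : ∀ j ∈ J, DepOn (B j) (g j)) :
    DepOn (J.biUnion B) (fun ω => ∏ j ∈ J, g j ω) := by
  intro ω ω' h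
  refine Finset.prod_congr rfl fun j hj => hg j hj ω ω' fun c hc => h c ?_
  exact Finset.mem_biUnion.2 ⟨j, hj, hc⟩

lemma Ex_indep_prod (hw : IsPr w) {ι : Type*} (J : Finset ι) (B : ι → Finset C)
    (g : ι → (C → Bool × Bool) → ℝ) (hg : ∀ j ∈ J, DepOn (B j) (g j))
    (hB : ∀ i ∈ J, ∀ j ∈ J, i ≠ j → Disjoint (B i) (B j)) :
    Ex w (fun ω => ∏ j ∈ J, g j ω) = ∏ j ∈ J, Ex w (g j) := by
  induction J using Finset.induction_on with
  | empty => simp [Ex_const hw]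
  | insert a s ha ih =>
    simp only [Finset.prod_insert ha]
    rw [Ex_indep hw (B := B a) (B' := s.biUnion B) ?_ (hg a (mem_insert_self _ _))
      (DepOn.prod s B g fun j hj => hg j (mem_insert_of_mem hj)), ih]
    · exact fun j hj => hg j (mem_insert_of_mem hj)
    · exact fun i hi j hj => hB i (mem_insert_of_mem hi) j (mem_insert_of_mem hj)
    · rw [Finset.disjoint_biUnion_right]
      intro j hj
      refine hB a (mem_insert_self _ _) j (mem_insert_of_mem hj) ?_
      rintro rfl; exact ha hj

lemma Ex_marg (hw : IsPr w) (i : C) (h : Bool × Bool → ℝ) :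
    Ex w (fun ω => h (ω i)) = ∑ b, w i b * h b := by
  have := Ex_prod (w := w) (fun c b => if c = i then h b else 1)
  have e : ∀ ω : C → Bool × Bool, (∏ c, if c = i then h (ω c) else 1) = h (ω i) := by
    intro ω; rw [Finset.prod_ite_eq' univ i (fun c => h (ω c))]; simp
  simp only [e] at this
  rw [this, Finset.prod_eq_single i]
  · simp
  · intro b _ hb; simp [hb, hw.one]
  · simp

lemma Ex_resample (hw : IsPr w) (i : C) (f : (C → Bool × Bool) → ℝ) :
    Ex w (fun ω => ∑ b, w i b * f (Function.update ω i b)) = Ex w f := by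
  rw [← Ex_swap hw (univ \ {i}) f]
  congr 1; funext ω
  rw [← Ex_marg hw i (fun b => f (Function.update ω i b))]
  congr 1; funext ω'
  congr 1; funext c
  by_cases h : c = i
  · subst h; simp [mrg]
  · simp [mrg, h]

/-! #### Averaging along a list of coordinates -/

def avgL (w : C → Bool × Bool → ℝ) : List C → ((C → Bool × Bool) → ℝ) → (C → Bool × Bool) → ℝ
  | [], f => f
  | i :: l, f => fun ω => ∑ b, w i b * avgL w l f (Function.update ω i b)

lemma Ex_avgL (hw : IsPr w) (l : List C) (f : (C → Bool × Bool) → ℝ) :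
    Ex w (avgL w l f) = Ex w f := by
  induction l with
  | nil => rfl
  | cons i l ih => rw [← ih]; exact Ex_resample hw i _

lemma avgL_update_of_indep (l : List C) (f : (C → Bool × Bool) → ℝ) (j : C)
    (hf : ∀ ω b, f (Function.update ω j b) = f ω) (ω b) :
    avgL w l f (Function.update ω j b) = avgL w l f ω := by
  induction l generalizing ω with
  | nil => exact hf ω b
  | cons i l ih =>
    simp only [avgL]
    refine Finset.sum_congr rfl fun b' _ => ?_
    by_cases h : i = j
    · subst h; simp
    · rw [Function.update_comm (Ne.symm h), ih]

lemma avgL_update_mem (l : List C) (f : (C → Bool × Bool) → ℝ) (j : C) (hj : j ∈ l) (ω b) :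
    avgL w l f (Function.update ω j b) = avgL w l f ω := by
  induction l generalizing ω with
  | nil => simp at hj
  | cons i l ih =>
    simp only [avgL]
    refine Finset.sum_congr rfl fun b' _ => ?_
    by_cases h : i = j
    · subst h; simp
    · have : j ∈ l := by
        rcases List.mem_cons.1 hj with h' | h'
        · exact absurd h'.symm h
        · exact h'
      rw [Function.update_comm (Ne.symm h), ih this]

lemma avgL_mono (hw : IsPr w) (l : List C) {f g : (C → Bool × Bool) → ℝ} (h : ∀ ω, f ω ≤ g ω) (ω) :
    avgL w l f ω ≤ avgL w l g ω := by
  induction l generalizing ω with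
  | nil => exact h ω
  | cons i l ih =>
    exact Finset.sum_le_sum fun b _ => mul_le_mul_of_nonneg_left (ih _) (hw.nn i b)

lemma avgL_mul (l : List C) (f g : (C → Bool × Bool) → ℝ)
    (hg : ∀ i ∈ l, ∀ ω b, g (Function.update ω i b) = g ω) (ω) :
    avgL w l (fun ω => g ω * f ω) ω = g ω * avgL w l f ω := by
  induction l generalizing ω with
  | nil => rfl
  | cons i l ih =>
    simp only [avgL]
    rw [Finset.mul_sum]
    refine Finset.sum_congr rfl fun b _ => ?_
    rw [ih fun i hi => hg i (List.mem_cons_of_mem _ hi), hg i List.mem_cons_self]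
    ring

lemma avgL_add (l : List C) (f g : (C → Bool × Bool) → ℝ) (ω) :
    avgL w l (fun ω => f ω + g ω) ω = avgL w l f ω + avgL w l g ω := by
  induction l generalizing ω with
  | nil => rfl
  | cons i l ih => simp only [avgL, ih, mul_add, Finset.sum_add_distrib]

lemma avgL_const (hw : IsPr w) (l : List C) (a : ℝ) (ω) :
    avgL w l (fun _ => a) ω = a := by
  induction l generalizing ω with
  | nil => rfl
  | cons i l ih => simp only [avgL, ih, ← Finset.sum_mul, hw.one, one_mul]

lemma avgL_sum (l : List C) {ι : Type*} (s : Finset ι) (e : ι → ℝ)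
    (f : ι → (C → Bool × Bool) → ℝ) (ω) :
    avgL w l (fun ω => ∑ i ∈ s, e i * f i ω) ω = ∑ i ∈ s, e i * avgL w l (f i) ω := by
  induction l generalizing ω with
  | nil => rfl
  | cons i l ih =>
    simp only [avgL, ih, Finset.mul_sum]
    rw [Finset.sum_comm]
    exact Finset.sum_congr rfl fun _ _ => Finset.sum_congr rfl fun _ _ => by ring

lemma avgL_coord (hw : IsPr w) (l : List C) (y : C) (h : Bool × Bool → ℝ) (ω) :
    avgL w l (fun ω => h (ω y)) ω = if y ∈ l then ∑ b, w y b * h b else h (ω y) := by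
  induction l generalizing ω with
  | nil => simp [avgL]
  | cons i l ih =>
    simp only [avgL, ih]
    by_cases hy : y ∈ l
    · simp [hy, ← Finset.sum_mul, hw.one]
    · by_cases hi : y = i
      · subst hi; simp [hy]
      · simp [hy, hi, ← Finset.sum_mul, hw.one]

lemma avgL_univ (hw : IsPr w) (f : (C → Bool × Bool) → ℝ) (l : List C) (hl : ∀ c, c ∈ l) (ω) :
    avgL w l f ω = Ex w f := by
  have hc : ∀ s : Finset C, ∀ ω' : C → Bool × Bool,
      avgL w l f (mrg s ω' ω) = avgL w l f ω := by
    intro s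
    induction s using Finset.induction_on with
    | empty => intro ω'; congr 1
    | insert a s ha ih =>
      intro ω'
      rw [← ih ω']
      have : mrg (insert a s) ω' ω = Function.update (mrg s ω' ω) a (ω' a) := by
        funext c
        by_cases h : c = a
        · subst h; simp [mrg]
        · simp [mrg, h]
      rw [this, avgL_update_mem l f a (hl a)]
  have h2 : ∀ ω', avgL w l f ω' = avgL w l f ω := by
    intro ω'
    rw [← hc univ ω']; congr 1; funext c; simp [mrg]
  rw [← Ex_avgL hw l f]
  have : (avgL w l f) = fun _ => avgL w l f ω := funext h2
  rw [this, Ex_const hw]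

end

section
variable {C : Type} [Fintype C] {w : C → Bool × Bool → ℝ}

lemma exp_le_quad (x : ℝ) : Real.exp x ≤ 1 + x + x ^ 2 * Real.exp |x| := by
  have h := Complex.norm_exp_sub_sum_le_norm_mul_exp (x : ℂ) 2
  have e : Complex.exp (x : ℂ) - ∑ m ∈ range 2, (x : ℂ) ^ m / (m.factorial : ℂ)
      = ((Real.exp x - (1 + x) : ℝ) : ℂ) := by
    simp [Finset.sum_range_succ]
  rw [e, Complex.norm_real, Complex.norm_real] at h
  simp only [Real.norm_eq_abs, sq_abs] at h
  linarith [le_abs_self (Real.exp x - (1 + x))]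

lemma one_step (u X : Bool × Bool → ℝ) (hu : ∀ b, 0 ≤ u b) (hu1 : ∑ b, u b = 1)
    (p D b0 s : ℝ) (hs : 0 ≤ s) (hp : u (true, true) + u (true, false) ≤ p)
    (hD : ∀ e, |X (true, e) - X (false, true)| ≤ D)
    (hb : ∀ e, |X (false, e) - X (false, true)| ≤ b0) :
    ∑ b, u b * Real.exp (s * X b) ≤ Real.exp (s * ∑ b, u b * X b +
      s ^ 2 * (p * D ^ 2 * Real.exp (s * D) + b0 ^ 2 * Real.exp (s * b0))) := by
  set x0 := X (false, true)
  have hD0 : 0 ≤ D := le_trans (abs_nonneg _) (hD true)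
  have hb0 : 0 ≤ b0 := le_trans (abs_nonneg _) (hb true)
  have key : ∀ (y B : ℝ), |y| ≤ B → Real.exp (s * y) ≤ 1 + s * y + s ^ 2 * (B ^ 2 * Real.exp (s * B)) := by
    intro y B hy
    have hB : 0 ≤ B := le_trans (abs_nonneg _) hy
    have h1 := exp_le_quad (s * y)
    have h2 : Real.exp |s * y| ≤ Real.exp (s * B) := by
      rw [Real.exp_le_exp, abs_mul, abs_of_nonneg hs]
      exact mul_le_mul_of_nonneg_left hy hs
    have h3 : (s * y) ^ 2 ≤ s ^ 2 * B ^ 2 := by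
      rw [mul_pow]
      refine mul_le_mul_of_nonneg_left ?_ (sq_nonneg s)
      rw [← sq_abs y]; exact pow_le_pow_left₀ (abs_nonneg _) hy 2
    have h4 : (s * y) ^ 2 * Real.exp |s * y| ≤ s ^ 2 * B ^ 2 * Real.exp (s * B) :=
      mul_le_mul h3 h2 (Real.exp_pos _).le (by positivity)
    linarith
  have e1 : ∑ b, u b * Real.exp (s * X b) =
      Real.exp (s * x0) * ∑ b, u b * Real.exp (s * (X b - x0)) := by
    rw [Finset.mul_sum]
    refine Finset.sum_congr rfl fun b _ => ?_
    rw [mul_left_comm, ← Real.exp_add]; congr 2; ring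
  set QD := s ^ 2 * (D ^ 2 * Real.exp (s * D)) with hQD
  set Qb := s ^ 2 * (b0 ^ 2 * Real.exp (s * b0)) with hQb
  have hQD0 : 0 ≤ QD := by positivity
  have hQb0 : 0 ≤ Qb := by positivity
  have e2 : ∑ b, u b * Real.exp (s * (X b - x0)) ≤
      1 + s * ∑ b, u b * (X b - x0) + (p * QD + Qb) := by
    rw [Fintype.sum_prod_type] at hu1 ⊢
    rw [Fintype.sum_prod_type]
    simp only [Fintype.sum_bool] at hu1 ⊢
    have a1 := mul_le_mul_of_nonneg_left (key _ _ (hD true)) (hu (true, true))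
    have a2 := mul_le_mul_of_nonneg_left (key _ _ (hD false)) (hu (true, false))
    have a3 := mul_le_mul_of_nonneg_left (key _ _ (hb true)) (hu (false, true))
    have a4 := mul_le_mul_of_nonneg_left (key _ _ (hb false)) (hu (false, false))
    have a5 := mul_le_mul_of_nonneg_right hp hQD0
    have a6 : (u (false, true) + u (false, false)) * Qb ≤ 1 * Qb :=
      mul_le_mul_of_nonneg_right (by linarith [hu (true, true), hu (true, false)]) hQb0
    rw [← hQD] at a1 a2
    rw [← hQb] at a3 a4
    nlinarith
  have e3 : ∑ b, u b * (X b - x0) = ∑ b, u b * X b - x0 := by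
    simp only [mul_sub, Finset.sum_sub_distrib, ← Finset.sum_mul, hu1, one_mul]
  rw [e1]
  rw [e3] at e2
  have e4 := le_trans e2 (by
    have := Real.add_one_le_exp (s * (∑ b, u b * X b - x0) + (p * QD + Qb))
    have h : 1 + s * (∑ b, u b * X b - x0) + (p * QD + Qb) ≤
      Real.exp (s * (∑ b, u b * X b - x0) + (p * QD + Qb)) := by linarith
    exact h)
  refine le_trans (mul_le_mul_of_nonneg_left e4 (Real.exp_pos _).le) ?_
  rw [← Real.exp_add]
  apply le_of_eq
  congr 1
  rw [hQD, hQb]; ring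

lemma avgL_update_notMem (l : List C) (f : (C → Bool × Bool) → ℝ) (i : C) (hi : i ∉ l) (b) (ω) :
    avgL w l f (Function.update ω i b) = avgL w l (fun ω => f (Function.update ω i b)) ω := by
  induction l generalizing ω with
  | nil => rfl
  | cons j l ih =>
    simp only [avgL]
    have hij : i ≠ j := fun h => hi (h ▸ List.mem_cons_self)
    refine Finset.sum_congr rfl fun b' _ => ?_
    rw [Function.update_comm hij, ih fun h => hi (List.mem_cons_of_mem _ h)]

lemma avgL_abs_sub (hw : IsPr w) (l : List C) (f g h : (C → Bool × Bool) → ℝ)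
    (H : ∀ ω, |f ω - g ω| ≤ h ω) (ω) : |avgL w l f ω - avgL w l g ω| ≤ avgL w l h ω := by
  rw [abs_le]
  constructor
  · have := avgL_mono hw l (f := g) (g := fun ω => f ω + h ω)
      (fun ω => by have := (abs_le.1 (H ω)).1; linarith) ω
    rw [avgL_add] at this; linarith
  · have := avgL_mono hw l (f := f) (g := fun ω => g ω + h ω)
      (fun ω => by have := (abs_le.1 (H ω)).2; linarith) ω
    rw [avgL_add] at this; linarith

def vTerm (s p D b : ℝ) : ℝ :=
  s ^ 2 * (p * D ^ 2 * Real.exp (s * D) + b ^ 2 * Real.exp (s * b))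

def Vt (w : C → Bool × Bool → ℝ) (s p : ℝ) (Δ : C → (C → Bool × Bool) → ℝ) (b0 : C → ℝ) :
    List C → (C → Bool × Bool) → ℝ
  | [] => fun _ => 0
  | i :: l => fun ω => vTerm s p (avgL w l (Δ i) ω) (b0 i) + Vt w s p Δ b0 l ω

lemma freedman (hw : IsPr w) (s p : ℝ) (hs : 0 ≤ s) (Δ : C → (C → Bool × Bool) → ℝ) (b0 : C → ℝ)
    (f : (C → Bool × Bool) → ℝ)
    (hp : ∀ i, w i (true, true) + w i (true, false) ≤ p)
    (hΔ : ∀ i ω e, |f (Function.update ω i (true, e)) - f (Function.update ω i (false, true))| ≤ Δ i ω)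
    (hb : ∀ i ω e, |f (Function.update ω i (false, e)) - f (Function.update ω i (false, true))| ≤ b0 i)
    (hΔi : ∀ i ω b, Δ i (Function.update ω i b) = Δ i ω)
    (l : List C) (hl : l.Nodup) (ω) :
    avgL w l (fun ω => Real.exp (s * f ω - Vt w s p Δ b0 l ω)) ω ≤ Real.exp (s * avgL w l f ω) := by
  induction l generalizing ω with
  | nil => simp [avgL, Vt]
  | cons i l ih =>
    have hil : i ∉ l := (List.nodup_cons.1 hl).1
    have ih := ih (List.nodup_cons.1 hl).2
    have e : (fun ω => Real.exp (s * f ω - Vt w s p Δ b0 (i :: l) ω)) =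
        fun ω => Real.exp (- vTerm s p (avgL w l (Δ i) ω) (b0 i)) *
          Real.exp (s * f ω - Vt w s p Δ b0 l ω) := by
      funext ω
      rw [← Real.exp_add]; congr 1; simp only [Vt]; ring
    have hinv : ∀ j ∈ i :: l, ∀ ω b,
        Real.exp (- vTerm s p (avgL w l (Δ i) (Function.update ω j b)) (b0 i)) =
        Real.exp (- vTerm s p (avgL w l (Δ i) ω) (b0 i)) := by
      intro j hj ω b
      rcases List.mem_cons.1 hj with rfl | hj
      · rw [avgL_update_of_indep l (Δ j) j (hΔi j)]
      · rw [avgL_update_mem l (Δ i) j hj]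
    rw [e, avgL_mul _ _ _ hinv]
    have h1 : avgL w (i :: l) (fun ω => Real.exp (s * f ω - Vt w s p Δ b0 l ω)) ω ≤
        ∑ b, w i b * Real.exp (s * avgL w l f (Function.update ω i b)) :=
      Finset.sum_le_sum fun b _ => mul_le_mul_of_nonneg_left (ih _) (hw.nn i b)
    have h2 := one_step (w i) (fun b => avgL w l f (Function.update ω i b)) (hw.nn i) (hw.one i)
      p (avgL w l (Δ i) ω) (b0 i) s hs (hp i)
      (fun e => by
        rw [avgL_update_notMem l f i hil, avgL_update_notMem l f i hil]
        exact avgL_abs_sub hw l _ _ _ (fun ω => hΔ i ω e) ω)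
      (fun e => by
        rw [avgL_update_notMem l f i hil, avgL_update_notMem l f i hil]
        refine le_trans (avgL_abs_sub hw l _ _ _ (fun ω => hb i ω e) ω) ?_
        rw [avgL_const hw])
    refine le_trans (mul_le_mul_of_nonneg_left (h1.trans h2) (Real.exp_pos _).le) ?_
    rw [← Real.exp_add]
    apply le_of_eq
    congr 1
    simp only [vTerm, avgL]; ring

lemma vTerm_mono {s p D D' b : ℝ} (hs : 0 ≤ s) (hp : 0 ≤ p) (hD : 0 ≤ D) (h : D ≤ D') :
    vTerm s p D b ≤ vTerm s p D' b := by
  unfold vTerm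
  gcongr

lemma Vt_le (hw : IsPr w) (s p : ℝ) (hs : 0 ≤ s) (hp : 0 ≤ p)
    (Δ Db : C → (C → Bool × Bool) → ℝ) (b0 : C → ℝ) (h0 : ∀ i ω, 0 ≤ Δ i ω)
    (h : ∀ l i ω, avgL w l (Δ i) ω ≤ Db i ω) (l : List C) (ω) :
    Vt w s p Δ b0 l ω ≤ (l.map fun i => vTerm s p (Db i ω) (b0 i)).sum := by
  induction l with
  | nil => simp [Vt]
  | cons i l ih =>
    simp only [Vt, List.map_cons, List.sum_cons]
    refine add_le_add (vTerm_mono hs hp ?_ (h l i ω)) ih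
    have := avgL_mono hw l (h0 i) ω
    rwa [avgL_const hw] at this

lemma freedman_tail (hw : IsPr w) (s p t v : ℝ) (hs : 0 ≤ s) (hp0 : 0 ≤ p)
    (Δ Db : C → (C → Bool × Bool) → ℝ) (b0 : C → ℝ)
    (f : (C → Bool × Bool) → ℝ)
    (hp : ∀ i, w i (true, true) + w i (true, false) ≤ p)
    (hΔ : ∀ i ω e, |f (Function.update ω i (true, e)) - f (Function.update ω i (false, true))| ≤ Δ i ω)
    (hb : ∀ i ω e, |f (Function.update ω i (false, e)) - f (Function.update ω i (false, true))| ≤ b0 i)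
    (hΔi : ∀ i ω b, Δ i (Function.update ω i b) = Δ i ω)
    (h0 : ∀ i ω, 0 ≤ Δ i ω)
    (h : ∀ l i ω, avgL w l (Δ i) ω ≤ Db i ω) :
    Ex w (fun ω => if Ex w f + t ≤ f ω ∧ ∑ i, vTerm s p (Db i ω) (b0 i) ≤ v then 1 else 0) ≤
      Real.exp (v - s * t) := by
  set l := (univ : Finset C).toList with hl
  have hmem : ∀ c, c ∈ l := fun c => by simp [hl]
  have hF : Ex w (fun ω => Real.exp (s * f ω - Vt w s p Δ b0 l ω)) ≤ Real.exp (s * Ex w f) := by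
    have := freedman hw s p hs Δ b0 f hp hΔ hb hΔi l (Finset.nodup_toList _) (fun _ => (false, false))
    rwa [avgL_univ hw _ l hmem, avgL_univ hw _ l hmem] at this
  have hV : ∀ ω, Vt w s p Δ b0 l ω ≤ ∑ i, vTerm s p (Db i ω) (b0 i) := by
    intro ω
    refine (Vt_le hw s p hs hp0 Δ Db b0 h0 h l ω).trans (le_of_eq ?_)
    rw [hl, Finset.sum_map_toList]
  calc _ ≤ Ex w (fun ω => Real.exp (v - s * t - s * Ex w f) *
        Real.exp (s * f ω - Vt w s p Δ b0 l ω)) := by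
        refine Ex_mono hw fun ω => ?_
        rw [← Real.exp_add]
        split_ifs with hc
        · rw [← Real.exp_zero, Real.exp_le_exp]
          have := hV ω
          nlinarith [mul_le_mul_of_nonneg_left hc.1 hs]
        · exact (Real.exp_pos _).le
    _ ≤ Real.exp (v - s * t - s * Ex w f) * Real.exp (s * Ex w f) := by
        rw [Ex_smul]
        exact mul_le_mul_of_nonneg_left hF (Real.exp_pos _).le
    _ = _ := by rw [← Real.exp_add]; congr 1; ring

end

def ind (P : Prop) : ℝ := if P then 1 else 0

lemma ind_nonneg (P : Prop) : 0 ≤ ind P := by unfold ind; split_ifs <;> norm_num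
lemma ind_le_one (P : Prop) : ind P ≤ 1 := by unfold ind; split_ifs <;> norm_num
lemma ind_true {P : Prop} (h : P) : ind P = 1 := by simp [ind, h]
lemma ind_false {P : Prop} (h : ¬P) : ind P = 0 := by simp [ind, h]
lemma ind_mono {P Q : Prop} (h : P → Q) : ind P ≤ ind Q := by
  by_cases hP : P
  · rw [ind_true hP, ind_true (h hP)]
  · rw [ind_false hP]; exact ind_nonneg _
lemma ind_or (P Q : Prop) : ind (P ∨ Q) ≤ ind P + ind Q := by
  by_cases hP : P
  · rw [ind_true (Or.inl hP), ind_true hP]; linarith [ind_nonneg Q]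
  · rw [ind_false hP, zero_add]; exact ind_mono fun h => h.resolve_left hP
lemma ind_and (P Q : Prop) : ind (P ∧ Q) = ind P * ind Q := by
  by_cases hP : P <;> by_cases hQ : Q <;> simp [ind, hP, hQ]
lemma ind_sub_le {P Q R : Prop} (h : ¬ R → (P ↔ Q)) : |ind P - ind Q| ≤ ind R := by
  by_cases hR : R
  · rw [ind_true hR, abs_le]
    constructor <;> linarith [ind_nonneg P, ind_nonneg Q, ind_le_one P, ind_le_one Q]
  · have : P = Q := propext (h hR)
    rw [this, sub_self, abs_zero]; exact ind_nonneg _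
lemma sum_ind {ι : Type*} (s : Finset ι) (P : ι → Prop) :
    ∑ i ∈ s, ind (P i) = ((s.filter P).card : ℝ) := by
  simp [ind]

section
variable {V C : Type} [Fintype V] [Fintype C] {G : SimpleGraph V} {H : SimpleGraph C}
  {L : V → Finset C} {d : ℝ}

def vtx (hcov : IsCorrespondenceCover G H L) (c : C) : V := (hcov.partition c).choose

lemma mem_L (hcov : IsCorrespondenceCover G H L) (c : C) (u : V) : c ∈ L u ↔ vtx hcov c = u := by
  have h := (hcov.partition c).choose_spec
  constructor
  · intro hu; exact (h.2 u hu).symm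
  · rintro rfl; exact h.1

lemma match_uniq (hcov : IsCorrespondenceCover G H L) {c a b : C} {u : V} (ha : a ∈ L u) (hb : b ∈ L u)
    (h1 : H.Adj c a) (h2 : H.Adj c b) : a = b :=
  hcov.matching (vtx hcov c) u c ((mem_L hcov _ _).2 rfl) a ha b hb h1 h2

lemma mem_K {ω : C → Bool × Bool} {c : C} :
    c ∈ Kset H ω ↔ (ω c).2 = true ∧ ∀ y, H.Adj c y → (ω y).1 = false := by
  simp [Kset]

lemma mem_A {ω : C → Bool × Bool} {c : C} : c ∈ Aset ω ↔ (ω c).1 = true := by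
  simp [Aset]

lemma mem_U (hcov : IsCorrespondenceCover G H L) {ω : C → Bool × Bool} {c : C} :
    c ∈ Uset H L ω ↔ ∀ y, vtx hcov y = vtx hcov c → ¬ ((ω y).1 = true ∧ y ∈ Kset H ω) := by
  simp only [Uset, mem_filter, mem_univ, true_and]
  constructor
  · intro h y hy ⟨h1, h2⟩
    have := h (vtx hcov c) ((mem_L hcov _ _).2 rfl)
    have h3 : y ∈ L (vtx hcov c) ∩ Aset ω ∩ Kset H ω := by
      simp only [mem_inter, mem_A]
      exact ⟨⟨(mem_L hcov _ _).2 hy, h1⟩, h2⟩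
    rw [this] at h3; simp at h3
  · intro h u hu
    rw [Finset.eq_empty_iff_forall_notMem]
    intro y hy
    simp only [mem_inter, mem_A] at hy
    refine h y ?_ ⟨hy.1.2, hy.2⟩
    rw [(mem_L hcov _ _).1 hu, (mem_L hcov _ _).1 hy.1.1]

/-- edges at `L v` -/
def Ed (H : SimpleGraph C) (L : V → Finset C) (v : V) : Finset (C × C) :=
  ((L v) ×ˢ (univ : Finset C)).filter fun e => H.Adj e.1 e.2

lemma mem_Ed {v : V} {e : C × C} : e ∈ Ed H L v ↔ e.1 ∈ L v ∧ H.Adj e.1 e.2 := by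
  simp [Ed]

/-- the good event for an edge -/
def XE (H : SimpleGraph C) (L : V → Finset C) (ω : C → Bool × Bool) (e : C × C) : Prop :=
  e.1 ∈ Kset H ω ∧ e.2 ∈ Kset H ω ∧ e.2 ∈ Uset H L ω

def Fun (H : SimpleGraph C) (L : V → Finset C) (v : V) (m : ℝ) (ω : C → Bool × Bool) : ℝ :=
  ∑ e ∈ Ed H L v, ind (XE H L ω e) - m * ∑ c ∈ L v, ind (c ∈ Kset H ω)

def Infl (hcov : IsCorrespondenceCover G H L) (x : C) (e : C × C) : Prop :=
  e.1 = x ∨ e.2 = x ∨ H.Adj e.1 x ∨ H.Adj e.2 x ∨ vtx hcov e.2 = vtx hcov x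

def ecnt (hcov : IsCorrespondenceCover G H L) (v : V) (y : C) : ℝ :=
  ∑ e ∈ Ed H L v, ind (vtx hcov e.2 = vtx hcov y)

def acnt (hcov : IsCorrespondenceCover G H L) (v : V) (m : ℝ) (x : C) : ℝ :=
  ∑ e ∈ Ed H L v, ind (Infl hcov x e) + m * ∑ c ∈ L v, ind (c = x ∨ H.Adj c x)

def bcnt (H : SimpleGraph C) (L : V → Finset C) (v : V) (m : ℝ) (x : C) : ℝ :=
  ∑ e ∈ Ed H L v, ind (e.1 = x ∨ e.2 = x) + m * ∑ c ∈ L v, ind (c = x)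

def DeltaF (hcov : IsCorrespondenceCover G H L) (v : V) (m : ℝ) (x : C) (ω : C → Bool × Bool) : ℝ :=
  acnt hcov v m x + ∑ y ∈ H.neighborFinset x, ecnt hcov v y * ind ((ω y).1 = true)

lemma K_iff_of_eq {ω ω' : C → Bool × Bool} {x : C} (h : ∀ y, y ≠ x → ω y = ω' y) {c : C}
    (hc : c ≠ x) (hx : ¬ H.Adj c x) : c ∈ Kset H ω ↔ c ∈ Kset H ω' := by
  rw [mem_K, mem_K, h c hc]
  refine and_congr_right fun _ => forall_congr' fun y => ?_
  refine imp_congr_right fun hy => ?_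
  rw [h y]; rintro rfl; exact hx hy

lemma K_iff_of_eq' {ω ω' : C → Bool × Bool} {x : C} (h : ∀ y, y ≠ x → ω y = ω' y)
    (hx : (ω x).1 = (ω' x).1) {c : C}
    (hc : c ≠ x) : c ∈ Kset H ω ↔ c ∈ Kset H ω' := by
  rw [mem_K, mem_K, h c hc]
  refine and_congr_right fun _ => forall_congr' fun y => ?_
  refine imp_congr_right fun hy => ?_
  by_cases hyx : y = x
  · subst hyx; rw [hx]
  · rw [h y hyx]

lemma XE_change (hcov : IsCorrespondenceCover G H L) {ω ω' : C → Bool × Bool} {x : C}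
    (h : ∀ y, y ≠ x → ω y = ω' y) (e : C × C) :
    |ind (XE H L ω e) - ind (XE H L ω' e)| ≤ ind (Infl hcov x e) +
      ∑ y ∈ H.neighborFinset x, ind (vtx hcov e.2 = vtx hcov y) * ind ((ω y).1 = true) := by
  have h1 : |ind (XE H L ω e) - ind (XE H L ω' e)| ≤ ind (Infl hcov x e ∨
      ∃ y, H.Adj x y ∧ vtx hcov e.2 = vtx hcov y ∧ (ω y).1 = true) := by
    apply ind_sub_le
    intro hn
    push Not at hn
    obtain ⟨hI, hy⟩ := hn
    unfold Infl at hI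
    push Not at hI
    obtain ⟨i1, i2, i3, i4, i5⟩ := hI
    unfold XE
    rw [K_iff_of_eq h i1 i3, K_iff_of_eq h i2 i4, mem_U hcov, mem_U hcov]
    refine and_congr_right fun _ => and_congr_right fun _ => ?_
    refine forall_congr' fun y => ?_
    refine imp_congr_right fun hyv => ?_
    have hyx : y ≠ x := by rintro rfl; exact i5 hyv.symm
    rw [h y hyx]
    apply not_congr
    refine and_congr_right fun hA => ?_
    apply K_iff_of_eq h hyx
    intro hadj
    have := hy y hadj.symm hyv.symm
    rw [h y hyx] at this
    exact this hA
  refine h1.trans ((ind_or _ _).trans (add_le_add le_rfl ?_))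
  by_cases hex : ∃ y, H.Adj x y ∧ vtx hcov e.2 = vtx hcov y ∧ (ω y).1 = true
  · rw [ind_true hex]
    obtain ⟨y, hy1, hy2, hy3⟩ := hex
    calc (1 : ℝ) = ind (vtx hcov e.2 = vtx hcov y) * ind ((ω y).1 = true) := by
          rw [ind_true hy2, ind_true hy3, mul_one]
      _ ≤ _ := Finset.single_le_sum
          (f := fun y => ind (vtx hcov e.2 = vtx hcov y) * ind ((ω y).1 = true))
          (fun i _ => mul_nonneg (ind_nonneg _) (ind_nonneg _)) (by simpa using hy1)
  · rw [ind_false hex]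
    exact Finset.sum_nonneg fun i _ => mul_nonneg (ind_nonneg _) (ind_nonneg _)

lemma abs_comb (P P' Q Q' m A B : ℝ) (hm : 0 ≤ m) (h1 : |P - P'| ≤ A) (h2 : |Q - Q'| ≤ B) :
    |(P - m * Q) - (P' - m * Q')| ≤ A + m * B := by
  have : (P - m * Q) - (P' - m * Q') = (P - P') - m * (Q - Q') := by ring
  rw [this]
  refine (abs_sub _ _).trans ?_
  rw [abs_mul, abs_of_nonneg hm]
  gcongr

lemma abs_sum_sub {ι : Type*} (s : Finset ι) (f g h : ι → ℝ) (H : ∀ i ∈ s, |f i - g i| ≤ h i) :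
    |∑ i ∈ s, f i - ∑ i ∈ s, g i| ≤ ∑ i ∈ s, h i := by
  rw [← Finset.sum_sub_distrib]
  exact (Finset.abs_sum_le_sum_abs _ _).trans (Finset.sum_le_sum H)

lemma Fun_change (hcov : IsCorrespondenceCover G H L) (v : V) {m : ℝ} (hm : 0 ≤ m)
    {ω ω' : C → Bool × Bool} {x : C} (h : ∀ y, y ≠ x → ω y = ω' y) :
    |Fun H L v m ω - Fun H L v m ω'| ≤ DeltaF hcov v m x ω := by
  have := abs_comb _ _ _ _ m _ _ hm
    (abs_sum_sub (Ed H L v) _ _ _ fun e _ => XE_change hcov h e)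
    (abs_sum_sub (L v) (fun c => ind (c ∈ Kset H ω)) (fun c => ind (c ∈ Kset H ω'))
      (fun c => ind (c = x ∨ H.Adj c x)) fun c _ => ind_sub_le fun hn => by
        push Not at hn; exact K_iff_of_eq h hn.1 hn.2)
  refine this.trans (le_of_eq ?_)
  unfold DeltaF acnt ecnt
  rw [Finset.sum_add_distrib, Finset.sum_comm]
  simp only [Finset.sum_mul]
  ring

lemma Fun_change' (hcov : IsCorrespondenceCover G H L) (v : V) {m : ℝ} (hm : 0 ≤ m)
    {ω ω' : C → Bool × Bool} {x : C} (h : ∀ y, y ≠ x → ω y = ω' y)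
    (hx : (ω x).1 = false) (hx' : (ω' x).1 = false) :
    |Fun H L v m ω - Fun H L v m ω'| ≤ bcnt H L v m x := by
  refine abs_comb _ _ _ _ m _ _ hm
    (abs_sum_sub (Ed H L v) _ _ _ fun e _ => ind_sub_le fun hn => ?_)
    (abs_sum_sub (L v) (fun c => ind (c ∈ Kset H ω)) (fun c => ind (c ∈ Kset H ω'))
      (fun c => ind (c = x)) fun c _ => ind_sub_le fun hn => by
        exact K_iff_of_eq' h (hx.trans hx'.symm) hn)
  push Not at hn
  have hxx := hx.trans hx'.symm
  unfold XE
  rw [K_iff_of_eq' h hxx hn.1, K_iff_of_eq' h hxx hn.2, mem_U hcov, mem_U hcov]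
  refine and_congr_right fun _ => and_congr_right fun _ => ?_
  refine forall_congr' fun y => imp_congr_right fun _ => not_congr ?_
  by_cases hy : y = x
  · subst hy; simp [hx, hx']
  · rw [h y hy, K_iff_of_eq' h hxx hy]

/-! counting -/
lemma card_Ed_snd (hcov : IsCorrespondenceCover G H L) (v : V) (P : C → Prop) :
    ∑ e ∈ Ed H L v, ind (P e.2) ≤ ((univ.filter P).card : ℝ) := by
  rw [sum_ind]
  norm_cast
  refine Finset.card_le_card_of_injOn (fun e => e.2) ?_ ?_
  · intro e he; simp at he ⊢; exact he.2
  · rintro ⟨a, b⟩ he ⟨a', b'⟩ he' hbb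
    simp only [coe_filter, mem_Ed, Set.mem_ofPred_eq] at he he' hbb
    subst hbb
    have := match_uniq hcov he.1.1 he'.1.1 he.1.2.symm he'.1.2.symm
    rw [this]

lemma card_Ed_fst (v : V) (x : C) :
    ∑ e ∈ Ed H L v, ind (e.1 = x) ≤ (H.degree x : ℝ) := by
  rw [sum_ind]
  norm_cast
  rw [← SimpleGraph.card_neighborFinset_eq_degree]
  refine Finset.card_le_card_of_injOn (fun e => e.2) ?_ ?_
  · intro e he
    simp only [coe_filter, mem_Ed, Set.mem_ofPred_eq] at he
    simp only [SimpleGraph.coe_neighborFinset, SimpleGraph.mem_neighborSet]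
    rw [← he.2]; exact he.1.2
  · rintro ⟨a, b⟩ he ⟨a', b'⟩ he' hbb
    simp only [coe_filter, mem_Ed, Set.mem_ofPred_eq] at he he' hbb
    rw [he.2, he'.2, hbb]

lemma card_Ed_adj_fst (hcov : IsCorrespondenceCover G H L) (v : V) (x : C) (hd : 0 ≤ d)
    (hdeg : ∀ c, (H.degree c : ℝ) ≤ 2 * d) :
    ∑ e ∈ Ed H L v, ind (H.Adj e.1 x) ≤ 2 * d := by
  by_cases hex : ∃ c ∈ L v, H.Adj c x
  · obtain ⟨c, hc, hcx⟩ := hex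
    refine le_trans (Finset.sum_le_sum fun e he => ?_) ((card_Ed_fst (H := H) v c).trans (hdeg c))
    refine ind_mono fun h => ?_
    exact match_uniq hcov (mem_Ed.1 he).1 hc h.symm hcx.symm
  · rw [Finset.sum_eq_zero]
    · linarith
    · intro e he; exact ind_false fun h => hex ⟨e.1, (mem_Ed.1 he).1, h⟩

lemma card_nbr (hdeg : ∀ c, (H.degree c : ℝ) ≤ 2 * d) (x : C) :
    ∑ y, ind (H.Adj x y) ≤ 2 * d := by
  rw [sum_ind]
  refine le_trans (le_of_eq ?_) (hdeg x)
  rw [← SimpleGraph.card_neighborFinset_eq_degree]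
  congr 2; ext; simp

lemma card_L_le {a : ℝ} (hcov : IsCorrespondenceCover G H L) (hL : ∀ u, ((L u).card : ℝ) ≤ a) (y : C) :
    ∑ z, ind (vtx hcov z = vtx hcov y) ≤ a := by
  rw [sum_ind]
  refine le_trans (le_of_eq ?_) (hL (vtx hcov y))
  congr 2; ext; simp [mem_L hcov]

lemma card_Ed (v : V) (hdeg : ∀ c, (H.degree c : ℝ) ≤ 2 * d) (hd : 1 ≤ d)
    (hL : ∀ u, ((L u).card : ℝ) ≤ 110 * d) : ((Ed H L v).card : ℝ) ≤ 220 * d ^ 2 := by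
  have h : ((Ed H L v).card : ℝ) = ∑ c ∈ L v, ∑ y, ind (H.Adj c y) := by
    rw [← Finset.sum_product' (L v) univ (fun c y => ind (H.Adj c y)), sum_ind]
    rfl
  rw [h]
  calc _ ≤ ∑ c ∈ L v, 2 * d := Finset.sum_le_sum fun c _ => card_nbr hdeg c
    _ = (L v).card * (2 * d) := by simp
    _ ≤ 110 * d * (2 * d) := by gcongr; exact hL v
    _ = _ := by ring

lemma ecnt_nonneg (hcov : IsCorrespondenceCover G H L) (v : V) (y : C) : 0 ≤ ecnt hcov v y :=
  Finset.sum_nonneg fun _ _ => ind_nonneg _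

lemma ecnt_le (hcov : IsCorrespondenceCover G H L) (v : V)
    (hL : ∀ u, ((L u).card : ℝ) ≤ 110 * d) (y : C) : ecnt hcov v y ≤ 110 * d := by
  refine (card_Ed_snd hcov v (fun c => vtx hcov c = vtx hcov y)).trans ?_
  rw [← sum_ind]; exact card_L_le hcov hL y

lemma ecnt_sum (hcov : IsCorrespondenceCover G H L) (v : V)
    (hdeg : ∀ c, (H.degree c : ℝ) ≤ 2 * d) (hd : 1 ≤ d)
    (hL : ∀ u, ((L u).card : ℝ) ≤ 110 * d) : ∑ y, ecnt hcov v y ≤ 24200 * d ^ 3 := by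
  unfold ecnt
  rw [Finset.sum_comm]
  calc _ ≤ ∑ e ∈ Ed H L v, 110 * d := Finset.sum_le_sum fun e _ => by
        refine le_trans (le_of_eq ?_) (card_L_le hcov hL e.2)
        simp only [eq_comm]
    _ = (Ed H L v).card * (110 * d) := by simp
    _ ≤ 220 * d ^ 2 * (110 * d) := by gcongr; exact card_Ed v hdeg hd hL
    _ = _ := by ring

lemma Infl_le (hcov : IsCorrespondenceCover G H L) (x : C) (e : C × C) :
    ind (Infl hcov x e) ≤ ind (e.1 = x) + ind (e.2 = x) + ind (H.Adj e.1 x) + ind (H.Adj e.2 x)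
      + ind (vtx hcov e.2 = vtx hcov x) := by
  unfold Infl
  linarith [ind_or (e.1 = x) (e.2 = x ∨ H.Adj e.1 x ∨ H.Adj e.2 x ∨ vtx hcov e.2 = vtx hcov x),
    ind_or (e.2 = x) (H.Adj e.1 x ∨ H.Adj e.2 x ∨ vtx hcov e.2 = vtx hcov x),
    ind_or (H.Adj e.1 x) (H.Adj e.2 x ∨ vtx hcov e.2 = vtx hcov x),
    ind_or (H.Adj e.2 x) (vtx hcov e.2 = vtx hcov x)]

lemma sum_ind_eq (x : C) : ∑ y, ind (x = y) = 1 := by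
  simp [ind]

lemma sum_ind_eq_le (s : Finset C) (x : C) : ∑ c ∈ s, ind (c = x) ≤ 1 := by
  rw [sum_ind]
  norm_cast
  rw [Finset.card_le_one]
  intro a ha b hb
  simp at ha hb; rw [ha.2, hb.2]

lemma acnt_nonneg (hcov : IsCorrespondenceCover G H L) (v : V) {m : ℝ} (hm : 0 ≤ m) (x : C) :
    0 ≤ acnt hcov v m x := by
  unfold acnt
  have h1 : 0 ≤ ∑ e ∈ Ed H L v, ind (Infl hcov x e) := Finset.sum_nonneg fun _ _ => ind_nonneg _
  have h2 : 0 ≤ ∑ c ∈ L v, ind (c = x ∨ H.Adj c x) := Finset.sum_nonneg fun _ _ => ind_nonneg _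
  positivity

lemma acnt_le (hcov : IsCorrespondenceCover G H L) (v : V) {m : ℝ} (hm : 0 ≤ m) (hm2 : m ≤ 2 * d)
    (hdeg : ∀ c, (H.degree c : ℝ) ≤ 2 * d) (hd : 1 ≤ d)
    (hL : ∀ u, ((L u).card : ℝ) ≤ 110 * d) (x : C) :
    acnt hcov v m x ≤ 200 * d := by
  have h1 : ∑ e ∈ Ed H L v, ind (Infl hcov x e) ≤ 117 * d := by
    refine (Finset.sum_le_sum fun e _ => Infl_le hcov x e).trans ?_
    simp only [Finset.sum_add_distrib]
    have a1 := (card_Ed_fst (H := H) (L := L) v x).trans (hdeg x)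
    have a2 : ∑ e ∈ Ed H L v, ind (e.2 = x) ≤ 1 := by
      refine (card_Ed_snd hcov v (fun c => c = x)).trans ?_
      rw [← sum_ind]; exact sum_ind_eq_le _ _
    have a3 := card_Ed_adj_fst hcov v x (by linarith) hdeg
    have a4 : ∑ e ∈ Ed H L v, ind (H.Adj e.2 x) ≤ 2 * d := by
      refine (card_Ed_snd hcov v (fun c => H.Adj c x)).trans ?_
      rw [← sum_ind]; simp only [H.adj_comm _ x]; exact card_nbr hdeg x
    have a5 := ecnt_le hcov v hL x
    unfold ecnt at a5
    linarith
  have h2 : ∑ c ∈ L v, ind (c = x ∨ H.Adj c x) ≤ 2 := by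
    refine (Finset.sum_le_sum fun c _ => ind_or _ _).trans ?_
    rw [Finset.sum_add_distrib]
    have b1 := sum_ind_eq_le (L v) x
    have b2 : ∑ c ∈ L v, ind (H.Adj c x) ≤ 1 := by
      rw [sum_ind]
      norm_cast
      rw [Finset.card_le_one]
      intro a ha b hb
      simp only [mem_filter] at ha hb
      exact match_uniq hcov ha.1 hb.1 ha.2.symm hb.2.symm
    linarith
  unfold acnt
  nlinarith

lemma acnt_sum (hcov : IsCorrespondenceCover G H L) (v : V) {m : ℝ} (hm : 0 ≤ m) (hm2 : m ≤ 2 * d)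
    (hdeg : ∀ c, (H.degree c : ℝ) ≤ 2 * d) (hd : 1 ≤ d)
    (hL : ∀ u, ((L u).card : ℝ) ≤ 110 * d) :
    ∑ x, acnt hcov v m x ≤ 30000 * d ^ 3 := by
  unfold acnt
  rw [Finset.sum_add_distrib, ← Finset.mul_sum, Finset.sum_comm,
    Finset.sum_comm (s := univ) (t := L v)]
  have h1 : ∑ e ∈ Ed H L v, ∑ x, ind (Infl hcov x e) ≤ 220 * d ^ 2 * (116 * d) := by
    calc _ ≤ ∑ e ∈ Ed H L v, 116 * d := Finset.sum_le_sum fun e _ => by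
          refine (Finset.sum_le_sum fun x _ => Infl_le hcov x e).trans ?_
          simp only [Finset.sum_add_distrib]
          rw [sum_ind_eq, sum_ind_eq]
          have a5 : ∑ x, ind (vtx hcov e.2 = vtx hcov x) ≤ 110 * d := by
            refine le_trans (le_of_eq ?_) (card_L_le hcov hL e.2)
            simp only [eq_comm]
          linarith [card_nbr hdeg e.1, card_nbr hdeg e.2]
      _ = (Ed H L v).card * (116 * d) := by simp
      _ ≤ 220 * d ^ 2 * (116 * d) := by gcongr; exact card_Ed v hdeg hd hL
  have h2 : ∑ c ∈ L v, ∑ x, ind (c = x ∨ H.Adj c x) ≤ 110 * d * (3 * d) := by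
    calc _ ≤ ∑ c ∈ L v, 3 * d := Finset.sum_le_sum fun c _ => by
          refine (Finset.sum_le_sum fun x _ => ind_or _ _).trans ?_
          rw [Finset.sum_add_distrib, sum_ind_eq]
          linarith [card_nbr hdeg c]
      _ = (L v).card * (3 * d) := by simp
      _ ≤ _ := by gcongr; exact hL v
  have h3 : m * ∑ c ∈ L v, ∑ x, ind (c = x ∨ H.Adj c x) ≤ 2 * d * (110 * d * (3 * d)) :=
    mul_le_mul hm2 h2 (Finset.sum_nonneg fun _ _ => Finset.sum_nonneg fun _ _ => ind_nonneg _)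
      (by linarith)
  have h4 : 0 < d ^ 3 := by positivity
  nlinarith

lemma bcnt_nonneg (v : V) {m : ℝ} (hm : 0 ≤ m) (x : C) :
    0 ≤ bcnt H L v m x := by
  unfold bcnt
  have h1 : 0 ≤ ∑ e ∈ Ed H L v, ind (e.1 = x ∨ e.2 = x) := Finset.sum_nonneg fun _ _ => ind_nonneg _
  have h2 : 0 ≤ ∑ c ∈ L v, ind (c = x) := Finset.sum_nonneg fun _ _ => ind_nonneg _
  positivity

lemma bcnt_le (hcov : IsCorrespondenceCover G H L) (v : V) {m : ℝ} (hm : 0 ≤ m) (hm2 : m ≤ 2 * d)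
    (hdeg : ∀ c, (H.degree c : ℝ) ≤ 2 * d) (hd : 1 ≤ d) (x : C) :
    bcnt H L v m x ≤ 5 * d := by
  have h1 : ∑ e ∈ Ed H L v, ind (e.1 = x ∨ e.2 = x) ≤ 3 * d := by
    refine (Finset.sum_le_sum fun e _ => ind_or _ _).trans ?_
    rw [Finset.sum_add_distrib]
    have a1 := (card_Ed_fst (H := H) (L := L) v x).trans (hdeg x)
    have a2 : ∑ e ∈ Ed H L v, ind (e.2 = x) ≤ 1 := by
      refine (card_Ed_snd hcov v (fun c => c = x)).trans ?_
      rw [← sum_ind]; exact sum_ind_eq_le _ _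
    linarith
  have h2 := sum_ind_eq_le (L v) x
  unfold bcnt
  nlinarith

lemma bcnt_sum (v : V) {m : ℝ} (hm : 0 ≤ m) (hm2 : m ≤ 2 * d)
    (hdeg : ∀ c, (H.degree c : ℝ) ≤ 2 * d) (hd : 1 ≤ d)
    (hL : ∀ u, ((L u).card : ℝ) ≤ 110 * d) :
    ∑ x, bcnt H L v m x ≤ 660 * d ^ 2 := by
  unfold bcnt
  rw [Finset.sum_add_distrib, ← Finset.mul_sum, Finset.sum_comm,
    Finset.sum_comm (s := univ) (t := L v)]
  have h1 : ∑ e ∈ Ed H L v, ∑ x, ind (e.1 = x ∨ e.2 = x) ≤ 220 * d ^ 2 * 2 := by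
    calc _ ≤ ∑ e ∈ Ed H L v, (2 : ℝ) := Finset.sum_le_sum fun e _ => by
          refine (Finset.sum_le_sum fun x _ => ind_or _ _).trans ?_
          rw [Finset.sum_add_distrib, sum_ind_eq, sum_ind_eq]; norm_num
      _ = (Ed H L v).card * 2 := by simp
      _ ≤ _ := by gcongr; exact card_Ed v hdeg hd hL
  have h2 : ∑ c ∈ L v, ∑ x, ind (c = x) ≤ 110 * d := by
    simp only [sum_ind_eq]
    simpa using hL v
  have h3 : m * ∑ c ∈ L v, ∑ x, ind (c = x) ≤ 2 * d * (110 * d) :=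
    mul_le_mul hm2 h2 (Finset.sum_nonneg fun _ _ => Finset.sum_nonneg fun _ _ => ind_nonneg _)
      (by linarith)
  nlinarith

end

section
variable {V C : Type} [Fintype V] [Fintype C] {G : SimpleGraph V} {H : SimpleGraph C}
  {L : V → Finset C} {d p : ℝ} {q : C → ℝ}

def wq (p : ℝ) (q : C → ℝ) (c : C) (b : Bool × Bool) : ℝ := bern p b.1 * bern (q c) b.2

lemma wq_isPr (hp0 : 0 ≤ p) (hp1 : p ≤ 1) (hq0 : ∀ c, 0 ≤ q c) (hq1 : ∀ c, q c ≤ 1) :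
    IsPr (wq p q) := by
  constructor
  · rintro c ⟨a, b⟩
    unfold wq bern
    have := hq0 c
    have := hq1 c
    refine mul_nonneg ?_ ?_ <;> split_ifs <;> linarith
  · intro c
    rw [Fintype.sum_prod_type]
    simp [wq, bern]
    ring

lemma wq_sum_A (c : C) (h : Bool → ℝ) : ∑ b, wq p q c b * h b.1 = p * h true + (1 - p) * h false := by
  rw [Fintype.sum_prod_type]
  simp [wq, bern]
  ring

lemma mgf_A (hp0 : 0 ≤ p) (z : C → ℝ) (hz0 : ∀ c, 0 ≤ z c) (hz1 : ∀ c, z c ≤ 1) :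
    Ex (wq p q) (fun ω => Real.exp (∑ y, z y * ind ((ω y).1 = true))) ≤
      Real.exp (2 * p * ∑ y, z y) := by
  have e : (fun ω : C → Bool × Bool => Real.exp (∑ y, z y * ind ((ω y).1 = true))) =
      fun ω => ∏ y, (fun y (b : Bool × Bool) => Real.exp (z y * ind (b.1 = true))) y (ω y) := by
    funext ω; rw [Real.exp_sum]
  rw [e, Ex_prod (w := wq p q) (fun y (b : Bool × Bool) => Real.exp (z y * ind (b.1 = true))), Finset.mul_sum, Real.exp_sum]
  refine Finset.prod_le_prod (fun y _ => ?_) (fun y _ => ?_)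
  · rw [wq_sum_A y (fun b => Real.exp (z y * ind (b = true)))]
    simp only [ind, if_true, mul_one]
    simp
    have := Real.add_one_le_exp (z y)
    nlinarith [hz0 y]
  · rw [wq_sum_A y (fun b => Real.exp (z y * ind (b = true)))]
    have h1 := Real.abs_exp_sub_one_sub_id_le (x := z y) (by rw [abs_of_nonneg (hz0 y)]; exact hz1 y)
    have h2 := (abs_le.1 h1).2
    have h3 := Real.add_one_le_exp (2 * p * z y)
    simp only [ind, if_true, mul_one]
    simp
    have h4 : z y ^ 2 ≤ z y := by nlinarith [hz0 y, hz1 y]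
    nlinarith

lemma tail_A (hw : IsPr (wq p q)) (hp0 : 0 ≤ p) (z : C → ℝ) (hz0 : ∀ c, 0 ≤ z c) (hz1 : ∀ c, z c ≤ 1)
    (σ : ℝ) :
    Ex (wq p q) (fun ω => ind (σ < ∑ y, z y * ind ((ω y).1 = true))) ≤
      Real.exp (2 * p * ∑ y, z y - σ) := by
  calc _ ≤ Ex (wq p q) (fun ω => Real.exp (-σ) * Real.exp (∑ y, z y * ind ((ω y).1 = true))) := by
        refine Ex_mono hw fun ω => ?_
        rw [← Real.exp_add]
        by_cases h : σ < ∑ y, z y * ind ((ω y).1 = true)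
        · rw [ind_true h]; exact Real.one_le_exp (by linarith)
        · rw [ind_false h]; exact (Real.exp_pos _).le
    _ ≤ Real.exp (-σ) * Real.exp (2 * p * ∑ y, z y) := by
        rw [Ex_smul]
        exact mul_le_mul_of_nonneg_left (mgf_A hp0 z hz0 hz1) (Real.exp_pos _).le
    _ = _ := by rw [← Real.exp_add]; congr 1; ring

def Db (hcov : IsCorrespondenceCover G H L) (v : V) (m p : ℝ) (x : C) (ω : C → Bool × Bool) : ℝ :=
  acnt hcov v m x + ∑ y ∈ H.neighborFinset x, ecnt hcov v y * (ind ((ω y).1 = true) + p)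

lemma avg_Delta (hw : IsPr (wq p q)) (hp0 : 0 ≤ p)
    (hcov : IsCorrespondenceCover G H L) (v : V) (m : ℝ) (l : List C) (x : C) (ω) :
    avgL (wq p q) l (DeltaF hcov v m x) ω ≤ Db hcov v m p x ω := by
  unfold DeltaF Db
  rw [avgL_add, avgL_const hw, avgL_sum l (H.neighborFinset x) (ecnt hcov v)
    (fun y ω => ind ((ω y).1 = true))]
  gcongr with y hy
  · exact ecnt_nonneg hcov v y
  · rw [avgL_coord hw l y (fun b => ind (b.1 = true))]
    split_ifs
    · rw [wq_sum_A y (fun b => ind (b = true))]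
      rw [ind_true rfl, ind_false (by simp)]
      linarith [ind_nonneg ((ω y).1 = true)]
    · linarith

def Bad1 (hcov : IsCorrespondenceCover G H L) (v : V) (τ : ℝ) (ω : C → Bool × Bool) : Prop :=
  ∃ x y, H.Adj x y ∧ ecnt hcov v y ≠ 0 ∧ τ < ∑ z, ind (H.Adj x z) * ind ((ω z).1 = true)

def Bad2 (hcov : IsCorrespondenceCover G H L) (v : V) (σ : ℝ) (ω : C → Bool × Bool) : Prop :=
  σ < ∑ y, ecnt hcov v y * ind ((ω y).1 = true)

lemma ecnt_ind (hcov : IsCorrespondenceCover G H L) (v : V) (y : C) :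
    ind (ecnt hcov v y ≠ 0) ≤ ecnt hcov v y := by
  unfold ecnt
  rw [sum_ind]
  unfold ind
  split_ifs with h
  · have : 0 < (filter (fun i => vtx hcov i.2 = vtx hcov y) (Ed H L v)).card :=
      Nat.pos_of_ne_zero (by exact_mod_cast h)
    exact_mod_cast this
  · positivity

lemma Bad1_pr (hw : IsPr (wq p q)) (hp0 : 0 ≤ p) (hpd : 4 * p * d ≤ 1)
    (hcov : IsCorrespondenceCover G H L) (v : V)
    (hdeg : ∀ c, (H.degree c : ℝ) ≤ 2 * d) (hd : 1 ≤ d)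
    (hL : ∀ u, ((L u).card : ℝ) ≤ 110 * d) (τ : ℝ) :
    Ex (wq p q) (fun ω => ind (Bad1 hcov v τ ω)) ≤ 48400 * d ^ 4 * Real.exp (1 - τ) := by
  have h1 : ∀ ω, ind (Bad1 hcov v τ ω) ≤ ∑ x, ∑ y, (ind (H.Adj x y) * ecnt hcov v y) *
      ind (τ < ∑ z, ind (H.Adj x z) * ind ((ω z).1 = true)) := by
    intro ω
    have nn : ∀ x y, 0 ≤ (ind (H.Adj x y) * ecnt hcov v y) *
      ind (τ < ∑ z, ind (H.Adj x z) * ind ((ω z).1 = true)) := fun x y =>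
        mul_nonneg (mul_nonneg (ind_nonneg _) (ecnt_nonneg hcov v y)) (ind_nonneg _)
    by_cases h : Bad1 hcov v τ ω
    · rw [ind_true h]
      obtain ⟨x, y, hxy, hy, hτ⟩ := h
      have h2 : 1 ≤ (ind (H.Adj x y) * ecnt hcov v y) *
          ind (τ < ∑ z, ind (H.Adj x z) * ind ((ω z).1 = true)) := by
        rw [ind_true hxy, ind_true hτ]
        have := ecnt_ind hcov v y
        rw [ind_true hy] at this
        linarith
      refine h2.trans ?_
      refine le_trans (Finset.single_le_sum (f := fun y => (ind (H.Adj x y) * ecnt hcov v y) *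
          ind (τ < ∑ z, ind (H.Adj x z) * ind ((ω z).1 = true))) (fun y _ => nn x y) (mem_univ y)) ?_
      exact Finset.single_le_sum (f := fun x => ∑ y, (ind (H.Adj x y) * ecnt hcov v y) *
          ind (τ < ∑ z, ind (H.Adj x z) * ind ((ω z).1 = true)))
          (fun x _ => Finset.sum_nonneg fun y _ => nn x y) (mem_univ x)
    · rw [ind_false h]
      exact Finset.sum_nonneg fun x _ => Finset.sum_nonneg fun y _ => nn x y
  refine (Ex_mono hw h1).trans ?_
  rw [Ex_sum]
  simp only [Ex_sum, Ex_smul]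
  have h3 : ∀ x, Ex (wq p q) (fun ω => ind (τ < ∑ z, ind (H.Adj x z) * ind ((ω z).1 = true))) ≤
      Real.exp (1 - τ) := by
    intro x
    refine (tail_A hw hp0 (fun z => ind (H.Adj x z)) (fun _ => ind_nonneg _)
      (fun _ => ind_le_one _) τ).trans ?_
    rw [Real.exp_le_exp]
    have := card_nbr hdeg x
    nlinarith [mul_le_mul_of_nonneg_left this hp0]
  calc _ ≤ ∑ x, ∑ y, (ind (H.Adj x y) * ecnt hcov v y) * Real.exp (1 - τ) := by
        refine Finset.sum_le_sum fun x _ => Finset.sum_le_sum fun y _ => ?_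
        exact mul_le_mul_of_nonneg_left (h3 x) (mul_nonneg (ind_nonneg _) (ecnt_nonneg hcov v y))
    _ = (∑ y, (∑ x, ind (H.Adj y x)) * ecnt hcov v y) * Real.exp (1 - τ) := by
        rw [Finset.sum_comm]
        simp only [Finset.sum_mul]
        refine Finset.sum_congr rfl fun y _ => Finset.sum_congr rfl fun x _ => ?_
        rw [H.adj_comm]
    _ ≤ (∑ y, 2 * d * ecnt hcov v y) * Real.exp (1 - τ) := by
        refine mul_le_mul_of_nonneg_right ?_ (Real.exp_pos _).le
        exact Finset.sum_le_sum fun y _ => mul_le_mul_of_nonneg_right (card_nbr hdeg y)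
          (ecnt_nonneg hcov v y)
    _ ≤ (2 * d * (24200 * d ^ 3)) * Real.exp (1 - τ) := by
        rw [← Finset.mul_sum]
        have := ecnt_sum hcov v hdeg hd hL
        gcongr
    _ = _ := by ring

lemma Bad2_pr (hw : IsPr (wq p q)) (hp0 : 0 ≤ p) (hpd : 4 * p * d ≤ 1)
    (hcov : IsCorrespondenceCover G H L) (v : V)
    (hdeg : ∀ c, (H.degree c : ℝ) ≤ 2 * d) (hd : 1 ≤ d)
    (hL : ∀ u, ((L u).card : ℝ) ≤ 110 * d) (τ : ℝ) (hτ : 24200 ≤ τ) :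
    Ex (wq p q) (fun ω => ind (Bad2 hcov v (τ * d ^ 2) ω)) ≤ Real.exp (-d) := by
  have hd0 : 0 < d := by linarith
  have e : (fun ω => ind (Bad2 hcov v (τ * d ^ 2) ω)) = fun ω : C → Bool × Bool =>
      ind (τ * d / 110 < ∑ y, (ecnt hcov v y / (110 * d)) * ind ((ω y).1 = true)) := by
    funext ω
    congr 1
    unfold Bad2
    have : ∑ y, (ecnt hcov v y / (110 * d)) * ind ((ω y).1 = true) =
      (∑ y, ecnt hcov v y * ind ((ω y).1 = true)) / (110 * d) := by
      rw [Finset.sum_div]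
      exact Finset.sum_congr rfl fun _ _ => by ring
    rw [this, lt_div_iff₀ (by positivity)]
    apply propext
    rw [show τ * d / 110 * (110 * d) = τ * d ^ 2 by ring]
  rw [e]
  refine (tail_A hw hp0 (fun y => ecnt hcov v y / (110 * d))
    (fun y => div_nonneg (ecnt_nonneg hcov v y) (by positivity))
    (fun y => (div_le_one (by positivity)).2 (ecnt_le hcov v hL y)) _).trans ?_
  rw [Real.exp_le_exp, ← Finset.sum_div]
  have h := ecnt_sum hcov v hdeg hd hL
  have h1 : (∑ y, ecnt hcov v y) / (110 * d) ≤ 220 * d ^ 2 := by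
    rw [div_le_iff₀ (by positivity)]; nlinarith
  have h2 : 2 * p * ((∑ y, ecnt hcov v y) / (110 * d)) ≤ 2 * p * (220 * d ^ 2) :=
    mul_le_mul_of_nonneg_left h1 (by positivity)
  nlinarith [mul_le_mul_of_nonneg_right hpd hd0.le, mul_le_mul_of_nonneg_right hτ hd0.le]

lemma V_good (hp0 : 0 ≤ p) (hpd : 4 * p * d ≤ 1)
    (hcov : IsCorrespondenceCover G H L) (v : V) {m : ℝ} (hm : 0 ≤ m) (hm2 : m ≤ 2 * d)
    (hdeg : ∀ c, (H.degree c : ℝ) ≤ 2 * d) (hd : 1 ≤ d)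
    (hL : ∀ u, ((L u).card : ℝ) ≤ 110 * d) (τ s : ℝ) (hτ : 24200 ≤ τ)
    (hs : 0 < s) (hs3 : s ^ 2 * d ^ 3 ≤ 1) (hsτ : s * (400 * d * τ) ≤ 1) (ω)
    (h1 : ¬ Bad1 hcov v τ ω) (h2 : ¬ Bad2 hcov v (τ * d ^ 2) ω) :
    ∑ x, vTerm s p (Db hcov v m p x ω) (bcnt H L v m x) ≤ 13000000 * τ ^ 2 := by
  have hd0 : 0 < d := by linarith
  have hsplit : ∀ x, Db hcov v m p x ω = acnt hcov v m x +
      ∑ y, ind (H.Adj x y) * (ecnt hcov v y * ind ((ω y).1 = true)) +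
      p * ∑ y, ind (H.Adj x y) * ecnt hcov v y := by
    intro x
    have : ∀ g : C → ℝ, ∑ y ∈ H.neighborFinset x, g y = ∑ y, ind (H.Adj x y) * g y := by
      intro g
      simp only [ind, ite_mul, one_mul, zero_mul]
      rw [← Finset.sum_filter]
      refine Finset.sum_congr ?_ fun _ _ => rfl
      ext; simp
    unfold Db
    rw [this, add_assoc, Finset.mul_sum, ← Finset.sum_add_distrib]
    congr 1
    exact Finset.sum_congr rfl fun _ _ => by ring
  have hD0 : ∀ x, 0 ≤ Db hcov v m p x ω := by
    intro x
    unfold Db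
    refine add_nonneg (acnt_nonneg hcov v hm x) (Finset.sum_nonneg fun y _ => ?_)
    exact mul_nonneg (ecnt_nonneg hcov v y) (add_nonneg (ind_nonneg _) hp0)
  have hDmax : ∀ x, Db hcov v m p x ω ≤ 400 * d * τ := by
    intro x
    rw [hsplit]
    have a1 := acnt_le hcov v hm hm2 hdeg hd hL x
    have a2 : ∑ y, ind (H.Adj x y) * (ecnt hcov v y * ind ((ω y).1 = true)) ≤ 110 * d * τ := by
      by_cases hex : ∃ y, H.Adj x y ∧ ecnt hcov v y ≠ 0
      · obtain ⟨y, hy1, hy2⟩ := hex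
        have hA : ∑ z, ind (H.Adj x z) * ind ((ω z).1 = true) ≤ τ := by
          by_contra hc
          exact h1 ⟨x, y, hy1, hy2, not_le.1 hc⟩
        calc _ ≤ ∑ y, 110 * d * (ind (H.Adj x y) * ind ((ω y).1 = true)) := by
              refine Finset.sum_le_sum fun y _ => ?_
              have := ecnt_le hcov v hL y
              have h3 : 0 ≤ ind (H.Adj x y) * ind ((ω y).1 = true) :=
                mul_nonneg (ind_nonneg _) (ind_nonneg _)
              nlinarith [mul_le_mul_of_nonneg_right this h3]
          _ ≤ _ := by rw [← Finset.mul_sum]; gcongr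
      · push Not at hex
        rw [Finset.sum_eq_zero]
        · positivity
        · intro y _
          by_cases hy : H.Adj x y
          · rw [hex y hy]; ring
          · rw [ind_false hy]; ring
    have a3 : ∑ y, ind (H.Adj x y) * ecnt hcov v y ≤ 2 * d * (110 * d) := by
      calc _ ≤ ∑ y, ind (H.Adj x y) * (110 * d) := by
            gcongr with y
            · exact ind_nonneg _
            · exact ecnt_le hcov v hL y
        _ ≤ _ := by rw [← Finset.sum_mul]; gcongr; exact card_nbr hdeg x
    have a4 := mul_le_mul_of_nonneg_left a3 hp0
    nlinarith [mul_le_mul_of_nonneg_right hpd hd0.le, mul_le_mul_of_nonneg_right hτ hd0.le]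
  have hDsum : ∑ x, Db hcov v m p x ω ≤ 42100 * d ^ 3 + 2 * d ^ 3 * τ := by
    simp only [hsplit]
    rw [Finset.sum_add_distrib, Finset.sum_add_distrib, ← Finset.mul_sum]
    have b1 := acnt_sum hcov v hm hm2 hdeg hd hL
    have sw : ∀ g : C → ℝ, (∀ y, 0 ≤ g y) → ∑ x, ∑ y, ind (H.Adj x y) * g y ≤ 2 * d * ∑ y, g y := by
      intro g hg
      rw [Finset.sum_comm, Finset.mul_sum]
      refine Finset.sum_le_sum fun y _ => ?_
      rw [← Finset.sum_mul]
      simp only [H.adj_comm _ y]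
      exact mul_le_mul_of_nonneg_right (card_nbr hdeg y) (hg y)
    have b2 := sw (fun y => ecnt hcov v y * ind ((ω y).1 = true))
      (fun y => mul_nonneg (ecnt_nonneg hcov v y) (ind_nonneg _))
    have b3 := sw (fun y => ecnt hcov v y) (fun y => ecnt_nonneg hcov v y)
    have b4 : ∑ y, ecnt hcov v y * ind ((ω y).1 = true) ≤ τ * d ^ 2 := not_lt.1 h2
    have b5 := ecnt_sum hcov v hdeg hd hL
    have b6 := mul_le_mul_of_nonneg_left b3 hp0
    have b7 : p * (2 * d * ∑ y, ecnt hcov v y) ≤ p * (2 * d * (24200 * d ^ 3)) := by gcongr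
    have b8 : 2 * d * ∑ y, ecnt hcov v y * ind ((ω y).1 = true) ≤ 2 * d * (τ * d ^ 2) := by gcongr
    have b9 := mul_le_mul_of_nonneg_right hpd (pow_nonneg hd0.le 3)
    nlinarith
  have he1 : Real.exp 1 ≤ 3 := by linarith [Real.exp_one_lt_d9]
  have hterm : ∀ x, vTerm s p (Db hcov v m p x ω) (bcnt H L v m x) ≤
      s ^ 2 * (300 * τ * Db hcov v m p x ω + 15 * d * bcnt H L v m x) := by
    intro x
    unfold vTerm
    set D := Db hcov v m p x ω
    set b := bcnt H L v m x
    have hb0 : 0 ≤ b := bcnt_nonneg v hm x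
    have hb1 : b ≤ 5 * d := bcnt_le hcov v hm hm2 hdeg hd x
    have e1 : Real.exp (s * D) ≤ 3 := by
      refine le_trans (Real.exp_le_exp.2 ?_) he1
      exact (mul_le_mul_of_nonneg_left (hDmax x) hs.le).trans hsτ
    have e2 : Real.exp (s * b) ≤ 3 := by
      refine le_trans (Real.exp_le_exp.2 ?_) he1
      refine (mul_le_mul_of_nonneg_left (hb1.trans ?_) hs.le).trans hsτ
      nlinarith
    have e3 : p * D ^ 2 ≤ 100 * τ * D := by
      have : p * D ≤ p * (400 * d * τ) := mul_le_mul_of_nonneg_left (hDmax x) hp0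
      have h4 : p * (400 * d * τ) ≤ 100 * τ := by nlinarith
      nlinarith [mul_le_mul_of_nonneg_right (this.trans h4) (hD0 x)]
    have e4 : b ^ 2 ≤ 5 * d * b := by nlinarith
    refine mul_le_mul_of_nonneg_left ?_ (by positivity)
    have e5 : p * D ^ 2 * Real.exp (s * D) ≤ 100 * τ * D * 3 :=
      mul_le_mul e3 e1 (Real.exp_pos _).le (by have := hD0 x; positivity)
    have e6 : b ^ 2 * Real.exp (s * b) ≤ 5 * d * b * 3 :=
      mul_le_mul e4 e2 (Real.exp_pos _).le (by positivity)
    linarith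
  refine (Finset.sum_le_sum fun x _ => hterm x).trans ?_
  rw [← Finset.mul_sum, Finset.sum_add_distrib, ← Finset.mul_sum, ← Finset.mul_sum]
  have c1 := bcnt_sum (H := H) (L := L) v hm hm2 hdeg hd hL
  have c2 : 300 * τ * ∑ x, Db hcov v m p x ω + 15 * d * ∑ x, bcnt H L v m x ≤
      d ^ 3 * (13000000 * τ ^ 2) := by
    have c3 : 300 * τ * ∑ x, Db hcov v m p x ω ≤ 300 * τ * (42100 * d ^ 3 + 2 * d ^ 3 * τ) := by gcongr
    have c4 : 15 * d * ∑ x, bcnt H L v m x ≤ 15 * d * (660 * d ^ 2) := by gcongr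
    have c5 : 300 * τ * (42100 + 2 * τ) + 9900 ≤ 13000000 * τ ^ 2 := by nlinarith
    have c6 := mul_le_mul_of_nonneg_left c5 (pow_nonneg hd0.le 3)
    nlinarith
  calc _ ≤ s ^ 2 * (d ^ 3 * (13000000 * τ ^ 2)) := by gcongr
    _ = s ^ 2 * d ^ 3 * (13000000 * τ ^ 2) := by ring
    _ ≤ 1 * (13000000 * τ ^ 2) := by gcongr
    _ = _ := one_mul _

lemma conc (hw : IsPr (wq p q)) (hp0 : 0 ≤ p) (hpd : 4 * p * d ≤ 1)
    (hcov : IsCorrespondenceCover G H L) (v : V) {m : ℝ} (hm : 0 ≤ m) (hm2 : m ≤ 2 * d)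
    (hdeg : ∀ c, (H.degree c : ℝ) ≤ 2 * d) (hd : 1 ≤ d)
    (hL : ∀ u, ((L u).card : ℝ) ≤ 110 * d) (τ s t : ℝ) (hτ : 24200 ≤ τ)
    (hs : 0 < s) (hs3 : s ^ 2 * d ^ 3 ≤ 1) (hsτ : s * (400 * d * τ) ≤ 1) :
    Ex (wq p q) (fun ω => ind (Ex (wq p q) (Fun H L v m) + t ≤ Fun H L v m ω)) ≤
      48400 * d ^ 4 * Real.exp (1 - τ) + Real.exp (-d) +
        Real.exp (13000000 * τ ^ 2 - s * t) := by
  have hF := freedman_tail hw s p t (13000000 * τ ^ 2) hs.le hp0 (DeltaF hcov v m) (Db hcov v m p)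
    (bcnt H L v m) (Fun H L v m)
    (fun i => by simp [wq, bern]; linarith)
    (fun x ω e => by
      refine (Fun_change hcov v hm (x := x) fun y hy => ?_).trans (le_of_eq ?_)
      · simp [hy]
      · unfold DeltaF
        congr 1
        refine Finset.sum_congr rfl fun y hy => ?_
        have : y ≠ x := by rintro rfl; simp at hy
        simp [this])
    (fun x ω e => by
      refine Fun_change' hcov v hm (x := x) (fun y hy => ?_) ?_ ?_
      · simp [hy]
      · simp
      · simp)
    (fun x ω b => by
      unfold DeltaF
      congr 1
      refine Finset.sum_congr rfl fun y hy => ?_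
      have : y ≠ x := by rintro rfl; simp at hy
      simp [this])
    (fun x ω => add_nonneg (acnt_nonneg hcov v hm x) (Finset.sum_nonneg fun y _ =>
      mul_nonneg (ecnt_nonneg hcov v y) (ind_nonneg _)))
    (fun l x ω => avg_Delta hw hp0 hcov v m l x ω)
  have h1 := Bad1_pr hw hp0 hpd hcov v hdeg hd hL τ
  have h2 := Bad2_pr hw hp0 hpd hcov v hdeg hd hL τ hτ
  refine le_trans ?_ (add_le_add (add_le_add h1 h2) hF)
  rw [← Ex_add, ← Ex_add]
  refine Ex_mono hw fun ω => ?_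
  by_cases hb1 : Bad1 hcov v τ ω
  · rw [ind_true hb1]
    have := ind_le_one (Ex (wq p q) (Fun H L v m) + t ≤ Fun H L v m ω)
    have := ind_nonneg (Bad2 hcov v (τ * d ^ 2) ω)
    split_ifs <;> linarith
  by_cases hb2 : Bad2 hcov v (τ * d ^ 2) ω
  · rw [ind_true hb2]
    have := ind_le_one (Ex (wq p q) (Fun H L v m) + t ≤ Fun H L v m ω)
    have := ind_nonneg (Bad1 hcov v τ ω)
    split_ifs <;> linarith
  have hV := V_good hp0 hpd hcov v hm hm2 hdeg hd hL τ s hτ hs hs3 hsτ ω hb1 hb2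
  rw [ind_false hb1, ind_false hb2]
  simp only [hV, and_true, zero_add]
  unfold ind
  rfl

end

section
variable {V C : Type} [Fintype V] [Fintype C] {G : SimpleGraph V} {H : SimpleGraph C}
  {L : V → Finset C} {d p keep : ℝ} {q : C → ℝ}

def cyl (R S Q : Finset C) (ω : C → Bool × Bool) : Prop :=
  (∀ c ∈ R, (ω c).1 = true) ∧ (∀ c ∈ S, (ω c).1 = false) ∧ (∀ c ∈ Q, (ω c).2 = true)

lemma Ex_cyl (R S Q : Finset C) (hRS : Disjoint R S) :
    Ex (wq p q) (fun ω => ind (cyl R S Q ω)) = p ^ R.card * (1 - p) ^ S.card * ∏ c ∈ Q, q c := by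
  have e : (fun ω : C → Bool × Bool => ind (cyl R S Q ω)) = fun ω => ∏ c,
      (fun c (b : Bool × Bool) => ind ((c ∈ R → b.1 = true) ∧ (c ∈ S → b.1 = false) ∧
        (c ∈ Q → b.2 = true))) c (ω c) := by
    funext ω
    by_cases h : cyl R S Q ω
    · rw [ind_true h, Finset.prod_eq_one]
      intro c _
      exact ind_true ⟨h.1 c, h.2.1 c, h.2.2 c⟩
    · rw [ind_false h]
      symm
      rw [Finset.prod_eq_zero_iff]
      by_contra hh
      push Not at hh
      apply h
      have : ∀ c, (c ∈ R → (ω c).1 = true) ∧ (c ∈ S → (ω c).1 = false) ∧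
        (c ∈ Q → (ω c).2 = true) := by
        intro c
        by_contra h3
        exact hh c (mem_univ c) (ind_false h3)
      exact ⟨fun c => (this c).1, fun c => (this c).2.1, fun c => (this c).2.2⟩
  rw [e, Ex_prod (w := wq p q) (fun c (b : Bool × Bool) => ind ((c ∈ R → b.1 = true) ∧
    (c ∈ S → b.1 = false) ∧ (c ∈ Q → b.2 = true)))]
  have h1 : ∀ c, ∑ b, wq p q c b * ind ((c ∈ R → b.1 = true) ∧
    (c ∈ S → b.1 = false) ∧ (c ∈ Q → b.2 = true)) =
      (if c ∈ R then p else 1) * (if c ∈ S then (1 - p) else 1) * (if c ∈ Q then q c else 1) := by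
    intro c
    have : ¬ (c ∈ R ∧ c ∈ S) := fun h => Finset.disjoint_left.1 hRS h.1 h.2
    rw [Fintype.sum_prod_type]
    by_cases hR : c ∈ R <;> by_cases hS : c ∈ S <;> by_cases hQ : c ∈ Q <;>
      simp_all [wq, bern, ind] <;> ring
  simp only [h1, Finset.prod_mul_distrib, Finset.prod_ite_mem, Finset.univ_inter, Finset.prod_const]

lemma cyl_dep (R S Q B : Finset C) (hR : R ⊆ B) (hS : S ⊆ B) (hQ : Q ⊆ B) :
    DepOn B (fun ω => ind (cyl R S Q ω)) := by
  intro ω ω' h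
  have : cyl R S Q ω = cyl R S Q ω' := by
    unfold cyl
    apply propext
    refine and_congr ?_ (and_congr ?_ ?_)
    · exact forall_congr' fun c => imp_congr_right fun hc => by rw [h c (hR hc)]
    · exact forall_congr' fun c => imp_congr_right fun hc => by rw [h c (hS hc)]
    · exact forall_congr' fun c => imp_congr_right fun hc => by rw [h c (hQ hc)]
  show ind _ = ind _
  rw [this]

lemma Ex_K (hq : ∀ c, q c * (1 - p) ^ (H.degree c) = keep) (c : C) :
    Ex (wq p q) (fun ω => ind (c ∈ Kset H ω)) = keep := by
  have e : (fun ω : C → Bool × Bool => ind (c ∈ Kset H ω)) =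
      fun ω => ind (cyl ∅ (H.neighborFinset c) {c} ω) := by
    funext ω
    congr 1
    rw [mem_K]
    simp [cyl]
    tauto
  rw [e, Ex_cyl _ _ _ (by simp)]
  simp
  rw [← hq c]; ring

lemma Ex_XE (hw : IsPr (wq p q)) (hp0 : 0 ≤ p) (hp1 : p < 1) (hq0 : ∀ c, 0 ≤ q c)
    (hq : ∀ c, q c * (1 - p) ^ (H.degree c) = keep)
    (hcov : IsCorrespondenceCover G H L) {c c' : C} (hc : H.Adj c c') :
    Ex (wq p q) (fun ω => ind (XE H L ω (c, c'))) ≤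
      keep ^ 2 * ((1 - p) ^ ((H.neighborFinset c ∩ H.neighborFinset c').card))⁻¹ *
        (1 - keep * p) ^ ((L (vtx hcov c')).card - 1) := by
  set S := H.neighborFinset c ∪ H.neighborFinset c' with hS
  set u := vtx hcov c'
  set J := (L u).erase c' with hJ
  set T : C → (C → Bool × Bool) → ℝ := fun x ω =>
    1 - ind (cyl {x} (H.neighborFinset x \ S) {x} ω)
  have hcS : c ∈ S := by simp [S, hc.symm]
  have hcS' : c' ∈ S := by simp [S, hc]
  have hcu : c' ∈ L u := (mem_L hcov _ _).2 rfl
  have h1 : ∀ ω, ind (XE H L ω (c, c')) ≤ ind (cyl ∅ S {c, c'} ω) * ∏ x ∈ J, T x ω := by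
    intro ω
    have hT : ∀ x ∈ J, 0 ≤ T x ω := fun x _ => sub_nonneg.2 (ind_le_one _)
    by_cases h : XE H L ω (c, c')
    · obtain ⟨hk, hk', hu⟩ := h
      simp only at hk hk' hu
      rw [mem_U hcov] at hu
      have k1 := mem_K.1 hk
      have k2 := mem_K.1 hk'
      have hSf : ∀ y ∈ S, (ω y).1 = false := by
        intro y hy
        simp [S] at hy
        rcases hy with hy | hy
        · exact k1.2 y hy
        · exact k2.2 y hy
      have hcy : cyl ∅ S {c, c'} ω := by
        refine ⟨by simp, hSf, ?_⟩
        intro y hy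
        simp at hy
        rcases hy with rfl | rfl
        · exact k1.1
        · exact k2.1
      rw [ind_true hcy, Finset.prod_eq_one]
      · linarith [ind_le_one (XE H L ω (c, c'))]
      · intro x hx
        have hxu : vtx hcov x = vtx hcov c' := (mem_L hcov _ _).1 (mem_of_mem_erase hx)
        have : ¬ cyl {x} (H.neighborFinset x \ S) {x} ω := by
          intro hh
          apply hu x hxu
          refine ⟨hh.1 x (by simp), mem_K.2 ⟨hh.2.2 x (by simp), ?_⟩⟩
          intro y hy
          by_cases hyS : y ∈ S
          · exact hSf y hyS
          · exact hh.2.1 y (by simp [hy, hyS])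
        simp only [T]
        rw [ind_false this, sub_zero]
    · rw [ind_false h]
      exact mul_nonneg (ind_nonneg _) (Finset.prod_nonneg hT)
  refine (Ex_mono hw h1).trans ?_
  set B : C → Finset C := fun x => insert x (H.neighborFinset x \ S)
  have hTd : ∀ x ∈ J, DepOn (B x) (T x) := by
    intro x _ ω ω' h
    have := cyl_dep {x} (H.neighborFinset x \ S) {x} (B x) (by simp [B]) (by simp [B]) (by simp [B]) ω ω' h
    simp only [T]
    simp only at this
    rw [this]
  have hxS : ∀ x ∈ J, x ∉ S := by
    intro x hx hxS
    have hx' := Finset.mem_erase.1 hx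
    simp [S] at hxS
    rcases hxS with h | h
    · exact hx'.1 (match_uniq hcov hx'.2 hcu h hc)
    · exact hcov.indep u c' hcu x hx'.2 h
  rw [Ex_indep hw (B := S) (B' := J.biUnion B) ?_
    (cyl_dep ∅ S {c, c'} S (by simp) le_rfl (by
      intro y hy; simp at hy; rcases hy with rfl | rfl <;> assumption))
    (DepOn.prod J B T hTd)]
  · rw [Ex_cyl _ _ _ (by simp), Ex_indep_prod hw J B T hTd]
    · have hpos : 0 < 1 - p := by linarith
      have e1 : p ^ (∅ : Finset C).card * (1 - p) ^ S.card * ∏ y ∈ {c, c'}, q y =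
        keep ^ 2 * ((1 - p) ^ ((H.neighborFinset c ∩ H.neighborFinset c').card))⁻¹ := by
        rw [Finset.prod_pair hc.ne]
        have hh := Finset.card_union_add_card_inter (H.neighborFinset c) (H.neighborFinset c')
        rw [eq_mul_inv_iff_mul_eq₀ (by positivity), pow_two]
        nth_rewrite 1 [← hq c]
        rw [← hq c', ← SimpleGraph.card_neighborFinset_eq_degree,
          ← SimpleGraph.card_neighborFinset_eq_degree]
        have : (1 - p) ^ S.card * (1 - p) ^ ((H.neighborFinset c ∩ H.neighborFinset c').card) =
          (1 - p) ^ (H.neighborFinset c).card * (1 - p) ^ (H.neighborFinset c').card := by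
          rw [← pow_add, ← pow_add, hS, hh]
        simp only [card_empty, pow_zero, one_mul]
        linear_combination (q c * q c') * this
      rw [e1]
      have hcard : (L u).card - 1 = J.card := by rw [hJ, Finset.card_erase_of_mem hcu]
      rw [hcard]
      have hk0 : 0 ≤ keep := by rw [← hq c]; exact mul_nonneg (hq0 c) (by positivity)
      refine mul_le_mul_of_nonneg_left ?_ (by positivity)
      rw [← Finset.prod_const]
      refine Finset.prod_le_prod (fun x hx => Ex_nonneg hw fun ω => sub_nonneg.2 (ind_le_one _)) ?_
      intro x hx
      have e2 : Ex (wq p q) (T x) = 1 - p * (1 - p) ^ (H.neighborFinset x \ S).card * q x := by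
        have := Ex_add (w := wq p q) (fun _ => 1)
          (fun ω => (-1) * ind (cyl {x} (H.neighborFinset x \ S) {x} ω))
        rw [Ex_smul, Ex_const hw, Ex_cyl _ _ _ (by simp)] at this
        have e3 : T x = fun ω => 1 + (-1) * ind (cyl {x} (H.neighborFinset x \ S) {x} ω) := by
          funext ω; simp only [T]; ring
        rw [e3, this]; simp; ring
      rw [e2, ← hq x]
      have : (1 - p) ^ (H.degree x) ≤ (1 - p) ^ (H.neighborFinset x \ S).card := by
        apply pow_le_pow_of_le_one hpos.le (by linarith)
        rw [← SimpleGraph.card_neighborFinset_eq_degree]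
        exact Finset.card_le_card Finset.sdiff_subset
      have h5 := mul_le_mul_of_nonneg_left this (mul_nonneg hp0 (hq0 x))
      linarith
    · intro i hi j hj hij
      have hi' := (Finset.mem_erase.1 hi).2
      have hj' := (Finset.mem_erase.1 hj).2
      rw [Finset.disjoint_left]
      intro y hy1 hy2
      simp only [B, mem_insert, mem_sdiff, SimpleGraph.mem_neighborFinset] at hy1 hy2
      rcases hy1 with rfl | hy1
      · rcases hy2 with rfl | hy2
        · exact hij rfl
        · exact hcov.indep u _ hj' _ hi' hy2.1
      · rcases hy2 with rfl | hy2
        · exact hcov.indep u _ hi' _ hj' hy1.1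
        · exact hij (match_uniq hcov hi' hj' hy1.1.symm hy2.1.symm)
  · rw [Finset.disjoint_left]
    intro y hy1 hy2
    simp only [B, mem_biUnion, mem_insert, mem_sdiff] at hy2
    obtain ⟨x, hx, rfl | hy⟩ := hy2
    · exact hxS _ hx hy1
    · exact hy.2 hy1

lemma inv_pow_bd {p : ℝ} (hp0 : 0 ≤ p) (hp1 : p < 1) (n : ℕ) (hn : n * p ≤ 1 / 2) :
    ((1 - p) ^ n)⁻¹ ≤ 1 + 2 * n * p := by
  have h := one_add_mul_le_pow (a := -p) (by linarith) n
  have h0 : 0 ≤ (n : ℝ) * p := by positivity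
  have hpos : 0 < (1 - p) ^ n := pow_pos (by linarith) n
  rw [inv_le_iff_one_le_mul₀ hpos]
  have h2 : 1 - n * p ≤ (1 - p) ^ n := by
    have : 1 + -p = 1 - p := by ring
    rw [this] at h; linarith
  nlinarith

lemma sum_codeg (c : C) : ∑ c' ∈ H.neighborFinset c,
    ((H.neighborFinset c ∩ H.neighborFinset c').card : ℝ) = pairsWithin H (H.neighborFinset c) := by
  unfold pairsWithin
  norm_cast
  rw [Finset.card_filter, Finset.sum_product]
  refine Finset.sum_congr rfl fun x hx => ?_
  rw [← Finset.card_filter]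
  congr 1
  ext y
  simp

lemma EF_bd (hw : IsPr (wq p q)) (hp0 : 0 ≤ p) (hp1 : p < 1) (hq0 : ∀ c, 0 ≤ q c)
    (hq : ∀ c, q c * (1 - p) ^ (H.degree c) = keep) (hpd : 4 * p * d ≤ 1)
    (hdeg : ∀ c, (H.degree c : ℝ) ≤ 2 * d)
    (hcov : IsCorrespondenceCover G H L) (v : V) {m k κ : ℝ} (hk : LocallySparse H k)
    (hκ0 : 0 ≤ κ) (hκ : ∀ u, (1 - keep * p) ^ ((L u).card - 1) ≤ κ) :
    Ex (wq p q) (Fun H L v m) ≤ keep ^ 2 * κ * (∑ c ∈ L v, (H.degree c : ℝ) + (L v).card * (4 * k * p))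
      - m * keep * (L v).card := by
  have e : Fun H L v m = fun ω => ∑ e ∈ Ed H L v, ind (XE H L ω e) +
      (-m) * ∑ c ∈ L v, ind (c ∈ Kset H ω) := by
    funext ω; unfold Fun; ring
  rw [e, Ex_add, Ex_smul, Ex_sum, Ex_sum]
  simp only [Ex_K hq, sum_const, nsmul_eq_mul]
  have h1 : ∑ e ∈ Ed H L v, Ex (wq p q) (fun ω => ind (XE H L ω e)) =
      ∑ c ∈ L v, ∑ c' ∈ H.neighborFinset c, Ex (wq p q) (fun ω => ind (XE H L ω (c, c'))) := by
    unfold Ed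
    rw [Finset.sum_filter, Finset.sum_product]
    refine Finset.sum_congr rfl fun c _ => ?_
    rw [← Finset.sum_filter]
    refine Finset.sum_congr ?_ fun _ _ => rfl
    ext y; simp
  have h2 : ∀ c, ∑ c' ∈ H.neighborFinset c, Ex (wq p q) (fun ω => ind (XE H L ω (c, c'))) ≤
      keep ^ 2 * κ * (H.degree c + 4 * k * p) := by
    intro c
    calc _ ≤ ∑ c' ∈ H.neighborFinset c, keep ^ 2 * κ *
          (1 + 2 * p * ((H.neighborFinset c ∩ H.neighborFinset c').card : ℝ)) := by
          refine Finset.sum_le_sum fun c' hc' => ?_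
          have hadj : H.Adj c c' := by simpa using hc'
          refine (Ex_XE hw hp0 hp1 hq0 hq hcov hadj).trans ?_
          have hn : ((H.neighborFinset c ∩ H.neighborFinset c').card : ℝ) * p ≤ 1 / 2 := by
            have : ((H.neighborFinset c ∩ H.neighborFinset c').card : ℝ) ≤ 2 * d := by
              refine le_trans ?_ (hdeg c)
              rw [← SimpleGraph.card_neighborFinset_eq_degree]
              exact_mod_cast Finset.card_le_card Finset.inter_subset_left
            nlinarith
          have h3 := inv_pow_bd hp0 hp1 _ hn
          have h4 := hκ (vtx hcov c')
          have h5 : 0 ≤ ((1 - p) ^ ((H.neighborFinset c ∩ H.neighborFinset c').card))⁻¹ :=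
            inv_nonneg.2 (pow_nonneg (by linarith) _)
          calc _ ≤ keep ^ 2 * ((1 - p) ^ ((H.neighborFinset c ∩ H.neighborFinset c').card))⁻¹ * κ :=
                mul_le_mul_of_nonneg_left h4 (by positivity)
            _ = keep ^ 2 * κ * ((1 - p) ^ ((H.neighborFinset c ∩ H.neighborFinset c').card))⁻¹ := by ring
            _ ≤ _ := mul_le_mul_of_nonneg_left (h3.trans (le_of_eq (by ring))) (by positivity)
      _ = keep ^ 2 * κ * (H.degree c + 2 * p * pairsWithin H (H.neighborFinset c)) := by
          rw [← Finset.mul_sum, Finset.sum_add_distrib, ← Finset.mul_sum, sum_codeg]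
          simp
      _ ≤ _ := by
          have := hk c
          refine mul_le_mul_of_nonneg_left ?_ (by positivity)
          nlinarith
  rw [h1]
  have h3 := Finset.sum_le_sum (s := L v) fun c _ => h2 c
  rw [← Finset.mul_sum, Finset.sum_add_distrib] at h3
  simp only [sum_const, nsmul_eq_mul] at h3
  linarith
end

section
variable {V C : Type} [Fintype V] [Fintype C] {G : SimpleGraph V} {H : SimpleGraph C}
  {L : V → Finset C}

lemma Fun_eq (v : V) (m : ℝ) (ω : C → Bool × Bool) :
    Fun H L v m ω = ∑ c ∈ L v ∩ Kset H ω,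
      (((H.neighborFinset c ∩ Kset H ω ∩ Uset H L ω).card : ℝ) - m) := by
  unfold Fun
  rw [Finset.sum_sub_distrib]
  congr 1
  · unfold Ed XE
    rw [Finset.sum_filter, Finset.sum_product, ← Finset.filter_mem_eq_inter, Finset.sum_filter]
    refine Finset.sum_congr rfl fun c _ => ?_
    rw [← Finset.sum_filter, sum_ind]
    by_cases hc : c ∈ Kset H ω
    · simp only [hc, true_and, if_true]
      congr 2
      ext y; simp
    · simp [hc]
  · have h2 : ∑ c ∈ L v, ind (c ∈ Kset H ω) = ((L v ∩ Kset H ω).card : ℝ) :=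
      (sum_ind (L v) (fun c => c ∈ Kset H ω)).trans (by congr 2; ext y; simp)
    rw [h2]
    simp [mul_comm]

lemma pointwise (hcov : IsCorrespondenceCover G H L) (v : V) (m ℓ' : ℝ) (hℓ : 0 < ℓ')
    (ω : C → Bool × Bool) (L' : V → Finset C)
    (hL' : L' = fun u => (L u ∩ Kset H ω).filter fun c =>
      ((H.neighborFinset c ∩ Kset H ω ∩ Uset H L ω).card : ℝ) ≤ m)
    (CS : Finset C)
    (hCS : CS = (univ.filter fun u : V => L u ∩ Aset ω ∩ Kset H ω = ∅).biUnion L') :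
    (((L' v).card : ℝ) / ℓ') * ((1 / ((L' v).card : ℝ)) *
      ∑ c ∈ L' v, ((H.neighborFinset c ∩ CS).card : ℝ)) + (1 - ((L' v).card : ℝ) / ℓ') * m ≤
      m + Fun H L v m ω / ℓ' := by
  have hsub : CS ⊆ Kset H ω ∩ Uset H L ω := by
    intro y hy
    rw [hCS, mem_biUnion] at hy
    obtain ⟨u, hu, hy⟩ := hy
    rw [hL'] at hy
    simp only [mem_filter, mem_inter, mem_univ, true_and] at hy hu ⊢
    refine ⟨hy.1.2, ?_⟩
    simp only [Uset, mem_filter, mem_univ, true_and]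
    intro w hw
    have h1 := (mem_L hcov _ _).1 hw
    have h2 := (mem_L hcov _ _).1 hy.1.1
    rw [← h1, h2]; exact hu
  have h1 : ∑ c ∈ L' v, (((H.neighborFinset c ∩ CS).card : ℝ) - m) ≤ Fun H L v m ω := by
    rw [Fun_eq]
    calc _ ≤ ∑ c ∈ L' v, (((H.neighborFinset c ∩ Kset H ω ∩ Uset H L ω).card : ℝ) - m) := by
          refine Finset.sum_le_sum fun c _ => ?_
          have : (H.neighborFinset c ∩ CS).card ≤ (H.neighborFinset c ∩ Kset H ω ∩ Uset H L ω).card := by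
            apply Finset.card_le_card
            rw [Finset.inter_assoc]
            exact Finset.inter_subset_inter_left hsub
          have : ((H.neighborFinset c ∩ CS).card : ℝ) ≤ (H.neighborFinset c ∩ Kset H ω ∩ Uset H L ω).card := by
            exact_mod_cast this
          linarith
      _ ≤ _ := by
          rw [hL']
          refine Finset.sum_le_sum_of_subset_of_nonneg (Finset.filter_subset _ _) ?_
          intro c hc hc'
          have : ¬ ((H.neighborFinset c ∩ Kset H ω ∩ Uset H L ω).card : ℝ) ≤ m := by
            intro h; exact hc' (Finset.mem_filter.2 ⟨hc, h⟩)
          linarith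
  have h2 : (((L' v).card : ℝ) / ℓ') * ((1 / ((L' v).card : ℝ)) *
      ∑ c ∈ L' v, ((H.neighborFinset c ∩ CS).card : ℝ)) + (1 - ((L' v).card : ℝ) / ℓ') * m =
      m + (∑ c ∈ L' v, (((H.neighborFinset c ∩ CS).card : ℝ) - m)) / ℓ' := by
    rw [Finset.sum_sub_distrib]
    simp only [sum_const, nsmul_eq_mul]
    by_cases h0 : (L' v) = ∅
    · rw [h0]; simp
    · have : ((L' v).card : ℝ) ≠ 0 := by
        simpa using h0
      field_simp
      ring
  rw [h2]
  gcongr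

lemma wcpPr_ge {η ℓ d : ℝ} (q : C → ℝ)
    (hq : ∀ c, q c = (1 - η / ℓ) ^ (2 * d) / (1 - η / ℓ) ^ ((H.degree c : ℝ)))
    (hw : IsPr (wq (η / ℓ) q)) (E B : (C → Bool × Bool) → Prop) (h : ∀ ω, ¬ B ω → E ω) :
    1 - Ex (wq (η / ℓ) q) (fun ω => ind (B ω)) ≤ wcpPr H η ℓ d E := by
  have e : wcpPr H η ℓ d E = Ex (wq (η / ℓ) q) (fun ω => ind (E ω)) := by
    unfold wcpPr Ex
    rw [Finset.sum_filter]
    refine Finset.sum_congr rfl fun ω _ => ?_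
    have : wcpWeight H η ℓ d ω = Wt (wq (η / ℓ) q) ω := by
      unfold wcpWeight Wt wq
      exact Finset.prod_congr rfl fun c _ => by rw [hq c]
    rw [this]
    show _ = _ * ind (E ω)
    by_cases hE : E ω
    · rw [ind_true hE, if_pos hE, mul_one]
    · rw [ind_false hE, if_neg hE, mul_zero]
  rw [e, sub_le_iff_le_add, ← Ex_add, ← Ex_const hw 1]
  refine Ex_mono hw fun ω => ?_
  by_cases hB : B ω
  · rw [ind_true hB]; linarith [ind_nonneg (E ω)]
  · rw [ind_true (h ω hB)]; linarith [ind_nonneg (B ω)]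
end

lemma log_lb {p : ℝ} (hp0 : 0 ≤ p) (hp : p ≤ 1 / 2) : -(p + 2 * p ^ 2) ≤ Real.log (1 - p) := by
  have h := Real.one_sub_inv_le_log_of_pos (x := 1 - p) (by linarith)
  refine le_trans ?_ h
  have h1 : (1 - p)⁻¹ ≤ 1 + p + 2 * p ^ 2 := by
    rw [inv_le_iff_one_le_mul₀ (by linarith)]
    nlinarith [mul_nonneg (sq_nonneg p) (by linarith : 0 ≤ 1 - 2 * p)]
  linarith

lemma exp_le_lin {x : ℝ} (h0 : 0 ≤ x) (h1 : x ≤ 1) : Real.exp x ≤ 1 + 2 * x := by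
  have h := Real.abs_exp_sub_one_sub_id_le (x := x) (by rwa [abs_of_nonneg h0])
  have := (abs_le.1 h).2
  nlinarith

lemma kappa_bd {p keep ℓ η β : ℝ} (hℓ : 0 < ℓ) (hη0 : 0 < η) (hη1 : η ≤ 1) (hpe : p = η / ℓ)
    (hp : p ≤ 1 / 2) (hk0 : 0 ≤ keep) (hk1 : keep ≤ 1) (hβ : 4 ≤ β * ℓ) (hβ1 : β ≤ 1 / 10)
    (n : ℕ) (hn : (1 - β) * ℓ / 2 ≤ n) :
    (1 - keep * p) ^ (n - 1) ≤ (1 - p) ^ (keep * ℓ / 2) * (1 + 2 * (η * β)) := by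
  have hp0 : 0 < p := by rw [hpe]; positivity
  have hpl : p * ℓ = η := by rw [hpe]; field_simp
  have hβ0 : 0 < β := by
    by_contra h; push Not at h; nlinarith
  have hn1 : 1 ≤ n := by
    rcases Nat.eq_zero_or_pos n with h | h
    · rw [h] at hn; push_cast at hn; nlinarith
    · exact h
  have hc : ((n - 1 : ℕ) : ℝ) = n - 1 := by rw [Nat.cast_sub hn1]; simp
  have h1 : (1 - keep * p) ^ (n - 1) ≤ Real.exp (-(keep * p) * (n - 1)) := by
    rw [← hc, mul_comm (-(keep * p)), Real.exp_nat_mul]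
    refine pow_le_pow_left₀ (by nlinarith) ?_ _
    have := Real.add_one_le_exp (-(keep * p)); linarith
  have h2 : (1 - p) ^ (keep * ℓ / 2) = Real.exp (Real.log (1 - p) * (keep * ℓ / 2)) :=
    Real.rpow_def_of_pos (by linarith) _
  have h3 : Real.exp (η * β) ≤ 1 + 2 * (η * β) :=
    exp_le_lin (by positivity) (by nlinarith)
  refine h1.trans ?_
  rw [h2]
  refine le_trans ?_ (mul_le_mul_of_nonneg_left h3 (Real.exp_pos _).le)
  rw [← Real.exp_add, Real.exp_le_exp]
  have h4 := mul_le_mul_of_nonneg_right (log_lb hp0.le hp) (by positivity : 0 ≤ keep * ℓ / 2)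
  have h5 : keep * p * ((1 - β) * ℓ / 2 - 1) ≤ keep * p * (n - 1) := by
    apply mul_le_mul_of_nonneg_left (by linarith) (by positivity)
  have h6 : keep * p * ((1 - β) * ℓ / 2 - 1) = keep * η / 2 - keep * (η * β) / 2 - keep * p := by
    rw [← hpl]; ring
  have h7 : -(p + 2 * p ^ 2) * (keep * ℓ / 2) = - (keep * η / 2) - keep * (p * η) := by
    rw [← hpl]; ring
  have h8 : p * 4 ≤ η * β := by
    rw [← hpl]; nlinarith
  have h9 : keep * (η * β / 2 + p + p * η) ≤ η * β := by
    have : p * η ≤ p := by nlinarith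
    have h10 : η * β / 2 + p + p * η ≤ η * β := by linarith
    have h11 : 0 ≤ η * β := by positivity
    nlinarith [mul_le_mul_of_nonneg_left h10 hk0]
  nlinarith

lemma ev_log (a A : ℝ) (ha : 0 < a) (hA : 0 < A) (n : ℕ) :
    ∀ᶠ d : ℝ in Filter.atTop, A * (Real.log d) ^ n ≤ d ^ a := by
  have h := (isLittleO_log_rpow_rpow_atTop (s := a) (n : ℝ) ha).bound (inv_pos.2 hA)
  filter_upwards [h, Filter.eventually_ge_atTop (1 : ℝ)] with d hd h1
  rw [Real.rpow_natCast, Real.norm_of_nonneg (pow_nonneg (Real.log_nonneg h1) n),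
    Real.norm_of_nonneg (Real.rpow_nonneg (by linarith) _)] at hd
  calc A * (Real.log d) ^ n ≤ A * (A⁻¹ * d ^ a) := mul_le_mul_of_nonneg_left hd hA.le
    _ = d ^ a := by field_simp

lemma exists_dt (γ a : ℝ) (hγ : γ < 1) (ha : 0 < a) : ∃ D : ℝ, ∀ d, D ≤ d →
    1 ≤ d ∧ 13000001 ≤ d ^ (1 / 10 : ℝ) ∧ 1 ≤ Real.log d ∧ 1 ≤ (1 - γ) * Real.log d ∧
      (Real.log d) ^ 10 ≤ d ^ (1 / 10 : ℝ) ∧ 100 * Real.log d ≤ d ^ (1 / 10 : ℝ) ∧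
      2 * (Real.log d) ^ 5 ≤ d ^ a := by
  have h1 := Filter.eventually_ge_atTop (1 : ℝ)
  have h2 := (tendsto_rpow_atTop (y := (1 / 10 : ℝ)) (by norm_num)).eventually_ge_atTop 13000001
  have h3 := Real.tendsto_log_atTop.eventually_ge_atTop 1
  have h4 := Real.tendsto_log_atTop.eventually_ge_atTop (1 / (1 - γ))
  have h5 := ev_log (1 / 10) 1 (by norm_num) one_pos 10
  have h6 := ev_log (1 / 10) 100 (by norm_num) (by norm_num) 1
  have h7 := ev_log a 2 ha (by norm_num) 5
  have := ((((((h1.and h2).and h3).and h4).and h5).and h6).and h7)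
  obtain ⟨D, hD⟩ := Filter.eventually_atTop.1 this
  refine ⟨D, fun d hd => ?_⟩
  obtain ⟨⟨⟨⟨⟨⟨g1, g2⟩, g3⟩, g4⟩, g5⟩, g6⟩, g7⟩ := hD d hd
  refine ⟨g1, g2, g3, ?_, by simpa using g5, by simpa using g6, g7⟩
  rw [div_le_iff₀ (by linarith)] at g4
  linarith

lemma tail_num {d x st : ℝ} (hx : 13000001 ≤ x) (hd : d = x ^ 10) (hlog : 100 * Real.log d ≤ x)
    (hst : 3 * x ^ 3 ≤ st) :
    48400 * d ^ 4 * Real.exp (1 - x) + Real.exp (-d) + Real.exp (13000000 * x ^ 2 - st) ≤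
      d ^ (-(50 : ℝ)) := by
  have hx0 : 0 < x := by linarith
  have hd0 : 0 < d := by rw [hd]; positivity
  have e1 : Real.exp (-x) ≤ (d ^ 100)⁻¹ := by
    have : Real.exp (-x) ≤ Real.exp (-((100 : ℕ) * Real.log d)) := by
      rw [Real.exp_le_exp]; push_cast; linarith
    refine this.trans (le_of_eq ?_)
    rw [Real.exp_neg, Real.exp_nat_mul, Real.exp_log hd0]
  have hdx : x ≤ d := by
    rw [hd]; exact le_self_pow₀ (by linarith) (by norm_num)
  have e2 : Real.exp (1 - x) ≤ 3 * (d ^ 100)⁻¹ := by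
    have : 1 - x = 1 + -x := by ring
    rw [this, Real.exp_add]
    have := Real.exp_one_lt_d9
    exact mul_le_mul (by linarith) e1 (Real.exp_pos _).le (by norm_num)
  have e3 : Real.exp (-d) ≤ (d ^ 100)⁻¹ := le_trans (Real.exp_le_exp.2 (by linarith)) e1
  have e4 : Real.exp (13000000 * x ^ 2 - st) ≤ (d ^ 100)⁻¹ := by
    refine le_trans (Real.exp_le_exp.2 ?_) e1
    have : 13000001 * x ^ 2 ≤ x * x ^ 2 := mul_le_mul_of_nonneg_right hx (by positivity)
    nlinarith
  have e5 : d ^ (-(50 : ℝ)) = (d ^ 50)⁻¹ := by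
    rw [Real.rpow_neg hd0.le]; norm_cast
  rw [e5]
  have hd1 : 145202 ≤ d := by linarith
  have h1 : (145202 * d ^ 4) * (d ^ 100)⁻¹ ≤ (d ^ 50)⁻¹ := by
    rw [← div_eq_mul_inv, ← one_div, div_le_div_iff₀ (by positivity) (by positivity)]
    have : d ^ 55 ≤ d ^ 100 := pow_le_pow_right₀ (by linarith) (by norm_num)
    have h3 : 145202 * d ^ 54 ≤ d * d ^ 54 := mul_le_mul_of_nonneg_right hd1 (by positivity)
    calc _ = 145202 * d ^ 54 := by ring
      _ ≤ _ := h3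
      _ = d ^ 55 := by ring
      _ ≤ _ := by linarith
  have h2 : 48400 * d ^ 4 * Real.exp (1 - x) ≤ 48400 * d ^ 4 * (3 * (d ^ 100)⁻¹) :=
    mul_le_mul_of_nonneg_left e2 (by positivity)
  have h3 : (1 : ℝ) ≤ d ^ 4 := one_le_pow₀ (by linarith)
  have h4 : 0 ≤ (d ^ 100)⁻¹ := by positivity
  nlinarith

set_option maxHeartbeats 4000000

/-- With probability at least `1 - d^{-50}`, the auxiliary quantity `δ'(v)` is at most
`(1 + β')d'`, under the assumptions (A1)–(A8) of the iteration lemma. -/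
theorem stmt15 (γ : ℝ) (hγ : γ ∈ Set.Ioo (0 : ℝ) 1) :
    ∃ dtilde : ℝ, ∀ η d ℓ k : ℝ,
      dtilde ≤ d →
      1 ≤ k → k ≤ d ^ (2 * γ) →
      4 * η * d < ℓ → ℓ < 100 * d →
      1 / (Real.log d) ^ 5 < η → η < 1 / Real.log (d / Real.sqrt k) →
      ∀ (V C : Type) [Fintype V] [Fintype C] (G : SimpleGraph V) (H : SimpleGraph C)
        (L : V → Finset C) (β : ℝ),
        IsCorrespondenceCover G H L →
        d ^ (-(γ * (1 - Real.sqrt γ)) / 200) ≤ β → β ≤ 1 / 10 →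
        LocallySparse H k →
        (∀ c : C, (H.degree c : ℝ) ≤ 2 * d) →
        (∀ v : V, (1 - β) * ℓ / 2 ≤ ((L v).card : ℝ) ∧ ((L v).card : ℝ) ≤ (1 + β) * ℓ) →
        (∀ v : V, (1 / ((L v).card : ℝ)) * ∑ c ∈ L v, (H.degree c : ℝ)
            ≤ (2 - (1 - β) * ℓ / ((L v).card : ℝ)) * d) →
        ∀ v : V,
          (let keep : ℝ := (1 - η / ℓ) ^ (2 * d);
           let uncolor : ℝ := (1 - η / ℓ) ^ (keep * ℓ / 2);
           let ℓ' : ℝ := keep * ℓ;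
           let d' : ℝ := keep * uncolor * d;
           let β' : ℝ := (1 + 36 * η) * β;
           1 - d ^ (-(50 : ℝ)) ≤
             wcpPr H η ℓ d (fun ω =>
               let L' : V → Finset C := fun u =>
                 (L u ∩ Kset H ω).filter fun c =>
                   ((H.neighborFinset c ∩ Kset H ω ∩ Uset H L ω).card : ℝ) ≤ 2 * d'
               let CS : Finset C :=
                 (univ.filter fun u : V => L u ∩ Aset ω ∩ Kset H ω = ∅).biUnion L'
               let ℓv' : ℝ := ((L' v).card : ℝ)
               let dbar : ℝ :=
                 (1 / ℓv') * ∑ c ∈ L' v, ((H.neighborFinset c ∩ CS).card : ℝ)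
               (ℓv' / ℓ') * dbar + (1 - ℓv' / ℓ') * (2 * d') ≤ (1 + β') * d')) := by
  have hγ0 := hγ.1
  have hγ1 := hγ.2
  have hsq : γ ≤ Real.sqrt γ := Real.le_sqrt_of_sq_le (by nlinarith)
  have hsq1 : Real.sqrt γ ≤ 1 := Real.sqrt_le_iff.2 ⟨by norm_num, by linarith⟩
  have hg1 : γ * (1 - Real.sqrt γ) ≤ 1 - γ := by nlinarith
  obtain ⟨D, hD⟩ := exists_dt γ (2 - 2 * γ - γ * (1 - Real.sqrt γ) / 200) hγ1 (by linarith)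
  refine ⟨D, ?_⟩
  intro η d ℓ k hd hk1 hk2 hℓ1 hℓ2 hη1 hη2 V C _ _ G H L β hcov hβ1 hβ2 hsp hdeg hL havg v
  obtain ⟨hd1, hx, hlog1, hlogγ, hlog10, hlog100, hloga⟩ := hD d hd
  intro keep uncolor ℓ' d' β'
  set x : ℝ := d ^ (1 / 10 : ℝ) with hxdef
  have hd0 : 0 < d := by linarith
  have hx0 : 0 < x := by linarith
  have hdx : d = x ^ 10 := by
    rw [hxdef, ← Real.rpow_natCast, ← Real.rpow_mul hd0.le]; norm_num
  set Lg : ℝ := (Real.log d) ^ 5 with hLg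
  have hLg1 : 1 ≤ Lg := one_le_pow₀ hlog1
  have hLg2 : Lg ^ 2 ≤ x := by rw [hLg, ← pow_mul]; exact hlog10
  have hη0 : 0 < η := lt_trans (by positivity) hη1
  have hηL : 1 ≤ η * Lg := by rw [div_lt_iff₀ (by positivity)] at hη1; exact hη1.le
  -- η ≤ 1
  have hη_le : η ≤ 1 := by
    have hsk : Real.sqrt k ≤ d ^ γ := by
      rw [Real.sqrt_le_left (by positivity), ← Real.rpow_natCast, ← Real.rpow_mul hd0.le]
      refine hk2.trans (le_of_eq ?_)
      congr 1; push_cast; ring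
    have hsk0 : 0 < Real.sqrt k := Real.sqrt_pos.2 (by linarith)
    have h1 : d ^ (1 - γ) ≤ d / Real.sqrt k := by
      rw [Real.rpow_sub hd0, Real.rpow_one]
      exact div_le_div_of_nonneg_left hd0.le hsk0 hsk
    have h2 : 1 ≤ Real.log (d / Real.sqrt k) := by
      refine le_trans ?_ (Real.log_le_log (by positivity) h1)
      rw [Real.log_rpow hd0]; exact hlogγ
    refine hη2.le.trans ?_
    rw [div_le_one (by linarith)]; exact h2
  have hβx : 1 / x ≤ β := by
    refine le_trans ?_ hβ1
    rw [hxdef, one_div, ← Real.rpow_neg hd0.le]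
    apply Real.rpow_le_rpow_of_exponent_le hd1
    linarith
  have hβx' : 1 ≤ β * x := by rwa [div_le_iff₀ hx0] at hβx
  have hβ0 : 0 < β := lt_of_lt_of_le (by positivity) hβx
  have hℓ0 : 0 < ℓ := lt_trans (by positivity) hℓ1
  set p : ℝ := η / ℓ with hp
  have hp0 : 0 < p := by positivity
  have hpℓ : p * ℓ = η := by rw [hp]; field_simp
  have hpd : 4 * p * d ≤ 1 := by
    rw [hp]
    have : 4 * (η / ℓ) * d = (4 * η * d) / ℓ := by ring
    rw [this, div_le_one hℓ0]; exact hℓ1.le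
  have hp2 : p ≤ 1 / 4 := by
    have := mul_le_mul_of_nonneg_left hd1 (by positivity : 0 ≤ 4 * p)
    linarith
  -- keep
  have hk0 : 0 < keep := Real.rpow_pos_of_pos (by linarith) _
  have hk_le : keep ≤ 1 := Real.rpow_le_one (by linarith) (by linarith) (by linarith)
  have hk_ge : 1 / 2 ≤ keep := by
    have := one_add_mul_self_le_rpow_one_add (s := -p) (by linarith) (p := 2 * d) (by linarith)
    have e : keep = (1 + -p) ^ (2 * d) := by
      show (1 - p) ^ (2 * d) = _
      rw [← sub_eq_add_neg]
    rw [e]; linarith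
  have hu0 : 0 < uncolor := Real.rpow_pos_of_pos (by linarith) _
  have hu_le : uncolor ≤ 1 := Real.rpow_le_one (by linarith) (by linarith) (by positivity)
  have hu_ge : 1 / 3 ≤ uncolor := by
    have e : uncolor = Real.exp (Real.log (1 - p) * (keep * ℓ / 2)) :=
      Real.rpow_def_of_pos (by linarith) _
    have h4 := mul_le_mul_of_nonneg_right (log_lb hp0.le (by linarith))
      (by positivity : 0 ≤ keep * ℓ / 2)
    have h7 : -(p + 2 * p ^ 2) * (keep * ℓ / 2) = - (keep * η / 2) - keep * (p * η) := by
      rw [← hpℓ]; ring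
    have h8 : keep * η ≤ 1 := mul_le_one₀ hk_le hη0.le hη_le
    have h9 : keep * (p * η) ≤ 1 / 4 := by
      have : keep * (p * η) = (keep * η) * p := by ring
      rw [this]
      have := mul_le_mul h8 hp2 hp0.le zero_le_one
      linarith
    have h10 : Real.exp (-1) ≤ uncolor := by
      rw [e, Real.exp_le_exp]; linarith
    refine le_trans ?_ h10
    rw [Real.exp_neg, one_div]
    apply inv_anti₀ (Real.exp_pos _)
    linarith [Real.exp_one_lt_d9]
  have hβℓ : 4 ≤ β * ℓ := by
    have h1 : 1 ≤ η * β * d := by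
      have h2 : Lg ≤ x := (le_self_pow₀ hLg1 (by norm_num)).trans hLg2
      have h3 : x * x ≤ d := by
        rw [hdx]
        calc x * x = x ^ 2 := by ring
          _ ≤ x ^ 10 := pow_le_pow_right₀ (by linarith) (by norm_num)
      calc (1 : ℝ) ≤ (η * Lg) * (β * x) := one_le_mul_of_one_le_of_one_le hηL hβx'
        _ ≤ (η * x) * (β * x) := by gcongr
        _ = (η * β) * (x * x) := by ring
        _ ≤ η * β * d := by gcongr
    have h4 := mul_le_mul_of_nonneg_left hℓ1.le hβ0.le
    linarith
  have hkd : 2 * k ≤ η * β * d ^ 2 := by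
    have h1 : 2 * Lg * (d ^ (2 * γ)) * d ^ (γ * (1 - Real.sqrt γ) / 200) ≤ d ^ 2 := by
      have e : d ^ 2 = d ^ (2 - 2 * γ - γ * (1 - Real.sqrt γ) / 200) * d ^ (2 * γ) *
          d ^ (γ * (1 - Real.sqrt γ) / 200) := by
        rw [← Real.rpow_add hd0, ← Real.rpow_add hd0, ← Real.rpow_natCast]
        congr 1; push_cast; ring
      rw [e]; gcongr
    set y : ℝ := d ^ (γ * (1 - Real.sqrt γ) / 200) with hy
    have hy0 : 0 < y := Real.rpow_pos_of_pos hd0 _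
    have h2 : 1 ≤ β * y := by
      rw [neg_div, Real.rpow_neg hd0.le, ← hy, inv_eq_one_div, div_le_iff₀ hy0] at hβ1
      exact hβ1
    have h3 : 1 ≤ (η * Lg) * (β * y) := one_le_mul_of_one_le_of_one_le hηL h2
    calc 2 * k ≤ 2 * d ^ (2 * γ) := by linarith
      _ ≤ 2 * d ^ (2 * γ) * ((η * Lg) * (β * y)) := le_mul_of_one_le_right (by positivity) h3
      _ = (η * β) * (2 * Lg * (d ^ (2 * γ)) * y) := by ring
      _ ≤ (η * β) * d ^ 2 := by gcongr
  -- the measure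
  set q : C → ℝ := fun c => (1 - p) ^ (2 * d) / (1 - p) ^ ((H.degree c : ℝ)) with hqdef
  have hpos : 0 < 1 - p := by linarith
  have hq0 : ∀ c, 0 ≤ q c := fun c => by positivity
  have hq1 : ∀ c, q c ≤ 1 := fun c => by
    simp only [hqdef]
    rw [div_le_one (by positivity)]
    exact Real.rpow_le_rpow_of_exponent_ge hpos (by linarith) (hdeg c)
  have hqk : ∀ c, q c * (1 - p) ^ (H.degree c) = keep := fun c => by
    simp only [hqdef]
    rw [Real.rpow_natCast, div_mul_cancel₀ _ (by positivity)]
  have hw : IsPr (wq p q) := wq_isPr hp0.le (by linarith) hq0 hq1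
  have hm0 : 0 ≤ 2 * d' := by positivity
  have hd'd : d' ≤ d := by
    show keep * uncolor * d ≤ d
    have : keep * uncolor ≤ 1 := mul_le_one₀ hk_le hu0.le hu_le
    exact mul_le_of_le_one_left hd0.le this
  have hLle : ∀ u, ((L u).card : ℝ) ≤ 110 * d := fun u => by
    have h1 := (hL u).2
    have h2 : (1 + β) * ℓ ≤ (11 / 10) * ℓ := mul_le_mul_of_nonneg_right (by linarith) hℓ0.le
    linarith
  have hEF := EF_bd hw hp0.le (by linarith) hq0 hqk hpd hdeg hcov v (m := 2 * d') hsp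
    (κ := uncolor * (1 + 2 * (η * β))) (by positivity)
    (fun u => kappa_bd hℓ0 hη0 hη_le hp (by linarith) hk0.le hk_le hβℓ hβ2 _ (hL u).1)
  set t : ℝ := 10 * (η * β) * (ℓ' * d') with ht
  have hst : 3 * x ^ 3 ≤ (x ^ 15)⁻¹ * t := by
    have h1 : 1 / 12 * (ℓ * d) ≤ ℓ' * d' := by
      have e : ℓ' * d' = (keep * keep * uncolor) * (ℓ * d) := by
        show keep * ℓ * (keep * uncolor * d) = _
        ring
      rw [e]
      have : 1 / 12 ≤ keep * keep * uncolor := by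
        have h8 : 1 / 2 * (1 / 2) ≤ keep * keep := mul_le_mul hk_ge hk_ge (by norm_num) hk0.le
        have h9 : 1 / 2 * (1 / 2) * (1 / 3) ≤ keep * keep * uncolor :=
          mul_le_mul h8 hu_ge (by norm_num) (by positivity)
        linarith
      gcongr
    have h2 : 3 * x ^ 18 ≤ t := by
      have h3 : x ^ 18 ≤ η ^ 2 * β * x ^ 20 := by
        have h4 : 1 ≤ (η * Lg) ^ 2 * (β * x) :=
          one_le_mul_of_one_le_of_one_le (one_le_pow₀ hηL) hβx'
        have h5 : (η * Lg) ^ 2 * (β * x) ≤ η ^ 2 * β * x ^ 2 := by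
          calc _ = η ^ 2 * β * x * Lg ^ 2 := by ring
            _ ≤ η ^ 2 * β * x * x := by gcongr
            _ = _ := by ring
        calc x ^ 18 = x ^ 18 * 1 := by ring
          _ ≤ x ^ 18 * (η ^ 2 * β * x ^ 2) := mul_le_mul_of_nonneg_left (h4.trans h5) (by positivity)
          _ = _ := by ring
      have h6 : 4 * (η ^ 2 * β * x ^ 20) ≤ (η * β) * (ℓ * d) := by
        calc 4 * (η ^ 2 * β * x ^ 20) = (η * β) * ((4 * η * d) * d) := by rw [hdx]; ring
          _ ≤ _ := by gcongr
      have h7 := mul_le_mul_of_nonneg_left h1 (by positivity : 0 ≤ 10 * (η * β))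
      rw [← ht] at h7
      have h8 := pow_pos hx0 18
      have h9 : 10 * (η * β) * (1 / 12 * (ℓ * d)) = 10 / 12 * ((η * β) * (ℓ * d)) := by ring
      rw [h9] at h7
      linarith
    rw [← div_eq_inv_mul, le_div_iff₀ (by positivity)]
    calc _ = 3 * x ^ 18 := by ring
      _ ≤ t := h2
  have hconc := conc hw hp0.le hpd hcov v hm0 (by linarith) hdeg hd1 hLle x (x ^ 15)⁻¹ t
    (by linarith) (by positivity)
    (by
      rw [hdx]
      apply le_of_eq
      field_simp)
    (by
      rw [hdx, ← div_eq_inv_mul, div_le_one (by positivity)]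
      calc 400 * x ^ 10 * x = 400 * x ^ 11 := by ring
        _ ≤ x * x ^ 11 := by gcongr; linarith
        _ = x ^ 12 := by ring
        _ ≤ x ^ 15 := pow_le_pow_right₀ (by linarith) (by norm_num))
  have htail := hconc.trans (tail_num hx hdx hlog100 hst)
  refine le_trans (by linarith) (wcpPr_ge q (fun c => rfl) hw _
    (fun ω => Ex (wq p q) (Fun H L v (2 * d')) + t ≤ Fun H L v (2 * d') ω) ?_)
  intro ω hω
  have hℓ'0 : 0 < ℓ' := by positivity
  have hd'0 : 0 < d' := by positivity
  refine (pointwise hcov v (2 * d') ℓ' hℓ'0 ω _ rfl _ rfl).trans ?_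
  push Not at hω
  have hEF2 : Ex (wq p q) (Fun H L v (2 * d')) ≤ (ℓ' * d') * (-1 + β + 4 * (η * β)) := by
    refine hEF.trans ?_
    set n : ℝ := ((L v).card : ℝ) with hn
    have hn1 : n ≤ (1 + β) * ℓ := (hL v).2
    have hn0 : 0 < n := by
      have h1 : 0 < (1 - β) * ℓ := mul_pos (by linarith) hℓ0
      exact lt_of_lt_of_le (by linarith) (hL v).1
    set Sd : ℝ := ∑ c ∈ L v, (H.degree c : ℝ) with hSd
    have hS : Sd ≤ 2 * n * d - (1 - β) * ℓ * d := by
      have h1 := mul_le_mul_of_nonneg_left (havg v) hn0.le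
      have e1 : n * (1 / n * Sd) = Sd := by field_simp
      have e2 : n * ((2 - (1 - β) * ℓ / n) * d) = 2 * n * d - (1 - β) * ℓ * d := by field_simp
      rw [← hn, ← hSd] at h1
      rw [e1, e2] at h1
      exact h1
    have hkp : n * (4 * k * p) ≤ 6 / 10 * (η * β) * (ℓ * d) := by
      have h1 : 4 * k * p * d ≤ (η * β * d) / 2 * d := by
        have : k * (4 * p * d) ≤ k * 1 := mul_le_mul_of_nonneg_left hpd (by linarith)
        have e3 : (η * β * d) / 2 * d = (η * β * d ^ 2) / 2 := by ring
        have e4 : 4 * k * p * d = k * (4 * p * d) := by ring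
        rw [e3, e4]; linarith
      have h2 : 4 * k * p ≤ (η * β * d) / 2 := le_of_mul_le_mul_right h1 hd0
      have h3 : n ≤ 11 / 10 * ℓ :=
        hn1.trans (mul_le_mul_of_nonneg_right (by linarith) hℓ0.le)
      calc n * (4 * k * p) ≤ (11 / 10 * ℓ) * ((η * β * d) / 2) := by
            apply mul_le_mul h3 h2 (by positivity) (by positivity)
        _ = 55 / 100 * ((η * β) * (ℓ * d)) := by ring
        _ ≤ 6 / 10 * ((η * β) * (ℓ * d)) := by
            apply mul_le_mul_of_nonneg_right (by norm_num) (by positivity)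
        _ = _ := by ring
    have e1 : keep ^ 2 * (uncolor * (1 + 2 * (η * β))) * (Sd + n * (4 * k * p)) - 2 * d' * keep * n =
        (keep ^ 2 * uncolor) * ((1 + 2 * (η * β)) * (Sd + n * (4 * k * p)) - 2 * d * n) := by
      show keep ^ 2 * (uncolor * (1 + 2 * (η * β))) * (Sd + n * (4 * k * p)) -
        2 * (keep * uncolor * d) * keep * n = _
      ring
    have e2 : (ℓ' * d') * (-1 + β + 4 * (η * β)) =
        (keep ^ 2 * uncolor) * ((ℓ * d) * (-1 + β + 4 * (η * β))) := by
      show (keep * ℓ) * (keep * uncolor * d) * (-1 + β + 4 * (η * β)) = _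
      ring
    rw [e1, e2]
    refine mul_le_mul_of_nonneg_left ?_ (by positivity)
    set ε : ℝ := η * β with hε
    have hε0 : 0 < ε := by positivity
    have hε1 : ε ≤ 1 / 10 := by
      have := mul_le_mul hη_le hβ2 hβ0.le zero_le_one
      linarith
    have h1 : (1 + 2 * ε) * (Sd + n * (4 * k * p)) ≤
        (1 + 2 * ε) * ((2 * n * d - (1 - β) * ℓ * d) + 6 / 10 * ε * (ℓ * d)) :=
      mul_le_mul_of_nonneg_left (by linarith) (by positivity)
    have hℓd : 0 < ℓ * d := by positivity
    have h2 : n * d ≤ 11 / 10 * (ℓ * d) := by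
      have h7 : n * d ≤ (11 / 10 * ℓ) * d := mul_le_mul_of_nonneg_right
        (hn1.trans (mul_le_mul_of_nonneg_right (by linarith) hℓ0.le)) hd0.le
      linarith
    have h3 : ε * (n * d) ≤ ε * (11 / 10 * (ℓ * d)) := mul_le_mul_of_nonneg_left h2 hε0.le
    have h4 : ε * (9 / 10 * (ℓ * d)) ≤ ε * ((1 - β) * (ℓ * d)) := by
      apply mul_le_mul_of_nonneg_left _ hε0.le
      apply mul_le_mul_of_nonneg_right (by linarith) hℓd.le
    have h5 : ε * (ε * (ℓ * d)) ≤ 1 / 10 * (ε * (ℓ * d)) :=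
      mul_le_mul_of_nonneg_right hε1 (by positivity)
    have h6 : 0 ≤ ε * (ℓ * d) := by positivity
    have e5 : (1 + 2 * ε) * ((2 * n * d - (1 - β) * ℓ * d) + 6 / 10 * ε * (ℓ * d)) - 2 * d * n =
      -(ℓ * d) + β * (ℓ * d) + 4 * (ε * (n * d)) - 2 * (ε * ((1 - β) * (ℓ * d))) +
        6 / 10 * (ε * (ℓ * d)) + 12 / 10 * (ε * (ε * (ℓ * d))) := by ring
    have e6 : (ℓ * d) * (-1 + β + 4 * ε) = -(ℓ * d) + β * (ℓ * d) + 4 * (ε * (ℓ * d)) := by ring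
    rw [e6]
    linarith
  have hF : Fun H L v (2 * d') ω / ℓ' ≤ d' * (-1 + β + 14 * (η * β)) := by
    rw [div_le_iff₀ hℓ'0]
    have : Fun H L v (2 * d') ω ≤ (ℓ' * d') * (-1 + β + 4 * (η * β)) + t := by linarith
    refine this.trans (le_of_eq ?_)
    rw [ht]; ring
  have hb : β' = β + 36 * (η * β) := by
    show (1 + 36 * η) * β = _
    ring
  rw [hb]
  have : 0 ≤ (η * β) * d' := by positivity
  have e7 : (1 + (β + 36 * (η * β))) * d' = 2 * d' + d' * (-1 + β + 14 * (η * β)) +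
    22 * ((η * β) * d') := by ring
  rw [e7]
  linarith
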